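/- Let X and Y be nodes in a PAG P such that there is a possibly directed path p* from X to Y in P that does not start with a visible edge out of X. Then there is a MAG M ∈ [P] such that the path p in M consisting of the same sequence of nodes as p* contains a subsequence that is a directed path from X to Y in M starting with an invisible edge. -/

import Mathlib

open scoped Classical

/-- Edge marks: tail, arrowhead, circle. -/
inductive Mark : Type
  | tail
  | arrow
  | circle
  deriving DecidableEq

/-- A partial mixed graph over a node set `V`: any two distinct nodes are joined by
at most one edge; `mark a b` is the mark at `b` on the edge between `a` and `b`
(`none` if there is no edge). -/
structure PMG (V : Type) where
  mark : V → V → Option Mark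
  symm : ∀ a b, (mark a b).isSome ↔ (mark b a).isSome
  irrefl : ∀ a, mark a a = none

namespace PMG

variable {V : Type}

/-- `a` and `b` are adjacent. -/
def Adj (G : PMG V) (a b : V) : Prop := (G.mark a b).isSome

/-- directed edge `a → b`. -/
def DirEdge (G : PMG V) (a b : V) : Prop :=
  G.mark a b = some Mark.arrow ∧ G.mark b a = some Mark.tail

/-- bidirected edge `a ↔ b`. -/
def BidirEdge (G : PMG V) (a b : V) : Prop :=
  G.mark a b = some Mark.arrow ∧ G.mark b a = some Mark.arrow

/-- non-directed edge `a o-o b`. -/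
def NondirEdge (G : PMG V) (a b : V) : Prop :=
  G.mark a b = some Mark.circle ∧ G.mark b a = some Mark.circle

/-- A path: a nonempty list of distinct nodes in which successive nodes are adjacent. -/
def IsPath (G : PMG V) (p : List V) : Prop :=
  p ≠ [] ∧ p.Nodup ∧ p.Chain' G.Adj

/-- A path from `a` to `b` (with at least one edge). -/
def IsPathFromTo (G : PMG V) (p : List V) (a b : V) : Prop :=
  IsPath G p ∧ p.head? = some a ∧ p.getLast? = some b ∧ 2 ≤ p.length

/-- All edges on `p` are directed towards the end of `p`. -/
def DirectedAlong (G : PMG V) (p : List V) : Prop :=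
  ∀ i a b, p[i]? = some a → p[i+1]? = some b → G.DirEdge a b

/-- No edge on `p` has an arrowhead at its endpoint closer to the start of `p`
(`p` is possibly directed). -/
def PossDirAlong (G : PMG V) (p : List V) : Prop :=
  ∀ i a b, p[i]? = some a → p[i+1]? = some b → G.mark b a ≠ some Mark.arrow

/-- `b` is a descendant of `a`: a directed path (possibly of length 0) from `a` to `b`. -/
def Descendant (G : PMG V) (a b : V) : Prop :=
  ∃ p, IsPath G p ∧ DirectedAlong G p ∧ p.head? = some a ∧ p.getLast? = some b

/-- `b` is a possible descendant of `a`. -/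
def PossDescendant (G : PMG V) (a b : V) : Prop :=
  ∃ p, IsPath G p ∧ PossDirAlong G p ∧ p.head? = some a ∧ p.getLast? = some b

/-- The node at position `i+1` of `p` is a collider on `p`. -/
def ColliderAt (G : PMG V) (p : List V) (i : ℕ) : Prop :=
  ∃ a b c, p[i]? = some a ∧ p[i+1]? = some b ∧ p[i+2]? = some c ∧
    G.mark a b = some Mark.arrow ∧ G.mark c b = some Mark.arrow

/-- The node at position `i+1` of `p` is a definite non-collider on `p`. -/
def DefNonColliderAt (G : PMG V) (p : List V) (i : ℕ) : Prop :=
  ∃ a b c, p[i]? = some a ∧ p[i+1]? = some b ∧ p[i+2]? = some c ∧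
    (G.mark a b = some Mark.tail ∨ G.mark c b = some Mark.tail ∨
      (G.mark a b = some Mark.circle ∧ G.mark c b = some Mark.circle ∧ ¬ G.Adj a c))

/-- `p` is of definite status. -/
def DefStatus (G : PMG V) (p : List V) : Prop :=
  ∀ i, i + 2 < p.length → (ColliderAt G p i ∨ DefNonColliderAt G p i)

/-- `p` is a definite status path that is m-connecting given `Z`. -/
def MConn (G : PMG V) (Z : Finset V) (p : List V) : Prop :=
  DefStatus G p ∧
  (∀ i b, p[i+1]? = some b → DefNonColliderAt G p i → b ∉ Z) ∧
  (∀ i b, p[i+1]? = some b → ColliderAt G p i → ∃ z ∈ Z, Descendant G b z)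

/-- `a` and `b` are m-separated given `Z`: every definite status path between them
is blocked by `Z`. -/
def MSep (G : PMG V) (a b : V) (Z : Finset V) : Prop :=
  ∀ p, IsPathFromTo G p a b → ¬ MConn G Z p

/-- Two graphs have the same m-separation relations. -/
def MarkovEquiv (G H : PMG V) : Prop :=
  ∀ a b (Z : Finset V), a ≠ b → a ∉ Z → b ∉ Z → (MSep G a b Z ↔ MSep H a b Z)

/-- `G` is a DAG: all edges directed and no directed cycle. -/
def IsDAG (G : PMG V) : Prop :=
  (∀ a b, G.Adj a b → G.DirEdge a b ∨ G.DirEdge b a) ∧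
  (∀ a b, Descendant G a b → Descendant G b a → a = b)

/-- A mixed graph: edges only `→` or `↔`. -/
def IsMixed (G : PMG V) : Prop :=
  ∀ a b, G.Adj a b → G.DirEdge a b ∨ G.DirEdge b a ∨ G.BidirEdge a b

/-- Ancestral mixed graph: no directed cycle, no almost directed cycle. -/
def IsAncestral (G : PMG V) : Prop :=
  IsMixed G ∧ (∀ a b, Descendant G a b → Descendant G b a → a = b) ∧
  (∀ a b, Descendant G a b → ¬ G.BidirEdge b a)

/-- Maximal ancestral graph. -/
def IsMAG (G : PMG V) : Prop :=
  IsAncestral G ∧ ∀ a b : V, a ≠ b → ¬ G.Adj a b →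
    ∃ Z : Finset V, a ∉ Z ∧ b ∉ Z ∧ MSep G a b Z

/-- A collider path from `v` to `x` that is into `x` and all of whose
non-endpoint nodes are parents of `y`. -/
def ColliderPathInto (G : PMG V) (v x y : V) : Prop :=
  ∃ p : List V, IsPathFromTo G p v x ∧
    (∀ i, i + 2 < p.length → ColliderAt G p i) ∧
    (∃ a, p[p.length - 2]? = some a ∧ G.mark a x = some Mark.arrow) ∧
    (∀ c ∈ p, c ≠ v → c ≠ x → G.DirEdge c y)

/-- The directed edge `x → y` is visible (in a MAG or PAG). -/
def Visible (G : PMG V) (x y : V) : Prop :=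
  G.DirEdge x y ∧
  ∃ v, v ≠ y ∧ ¬ G.Adj v y ∧
    (G.mark v x = some Mark.arrow ∨ ColliderPathInto G v x y)

/-- `p` is a proper path from the node set `X` to the node set `Y`. -/
def ProperPath (G : PMG V) (X Y : Finset V) (p : List V) : Prop :=
  IsPath G p ∧ (∃ a ∈ X, p.head? = some a) ∧ (∃ b ∈ Y, p.getLast? = some b) ∧
  (∀ c ∈ p.tail, c ∉ X)

/-- `p` starts with an edge satisfying `vis` out of its first node. -/
def StartsVisible (vis : V → V → Prop) (p : List V) : Prop :=
  ∃ a b, p[0]? = some a ∧ p[1]? = some b ∧ vis a b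

/-- Adjustment amenability relative to `(X,Y)`, with visibility predicate `vis`. -/
def Amenable (G : PMG V) (vis : V → V → Prop) (X Y : Finset V) : Prop :=
  ∀ p, ProperPath G X Y p → PossDirAlong G p → StartsVisible vis p

/-- Forbidden nodes: possible descendants of a node `w ∉ X` lying on a proper
possibly causal path from `X` to `Y`. -/
def Forb (G : PMG V) (X Y : Finset V) : Set V :=
  { v | ∃ w, w ∉ X ∧
      (∃ p, ProperPath G X Y p ∧ PossDirAlong G p ∧ w ∈ p) ∧
      PossDescendant G w v }

/-- Forbidden nodes in a DAG or MAG: descendants of a node `w ∉ X` lying on a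
proper causal path from `X` to `Y`. -/
def ForbD (G : PMG V) (X Y : Finset V) : Set V :=
  { v | ∃ w, w ∉ X ∧
      (∃ p, ProperPath G X Y p ∧ DirectedAlong G p ∧ w ∈ p) ∧
      Descendant G w v }

/-- The generalized adjustment criterion (GAC) relative to `(X,Y)`, with
visibility predicate `vis`. -/
def GAC (G : PMG V) (vis : V → V → Prop) (X Y Z : Finset V) : Prop :=
  Amenable G vis X Y ∧
  (∀ z ∈ Z, z ∉ Forb G X Y) ∧
  (∀ p, ProperPath G X Y p → DefStatus G p → ¬ PossDirAlong G p → ¬ MConn G Z p)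

/-- The adjustment criterion (AC) for DAGs and MAGs relative to `(X,Y)`, with
visibility predicate `vis`. -/
def AC (H : PMG V) (vis : V → V → Prop) (X Y Z : Finset V) : Prop :=
  (∀ p, ProperPath H X Y p → DirectedAlong H p → StartsVisible vis p) ∧
  (∀ z ∈ Z, z ∉ ForbD H X Y) ∧
  (∀ p, ProperPath H X Y p → ¬ PossDirAlong H p → ¬ MConn H Z p)

/-- `cls` is the Markov equivalence class of DAGs represented by the CPDAG `G`. -/
def IsCPDAGOf (G : PMG V) (cls : Set (PMG V)) : Prop :=
  cls.Nonempty ∧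
  (∀ D ∈ cls, IsDAG D) ∧
  (∀ D ∈ cls, ∀ D', IsDAG D' → MarkovEquiv D D' → D' ∈ cls) ∧
  (∀ D ∈ cls, ∀ D' ∈ cls, MarkovEquiv D D') ∧
  (∀ D ∈ cls, ∀ a b, G.Adj a b ↔ D.Adj a b) ∧
  (∀ a b, G.Adj a b → (G.DirEdge a b ∨ G.NondirEdge a b)) ∧
  (∀ a b, G.DirEdge a b ↔ (G.Adj a b ∧ ∀ D ∈ cls, D.DirEdge a b))

/-- `cls` is the Markov equivalence class of MAGs represented by the PAG `P`. -/
def IsPAGOf (P : PMG V) (cls : Set (PMG V)) : Prop :=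
  cls.Nonempty ∧
  (∀ M ∈ cls, IsMAG M) ∧
  (∀ M ∈ cls, ∀ M', IsMAG M' → MarkovEquiv M M' → M' ∈ cls) ∧
  (∀ M ∈ cls, ∀ M' ∈ cls, MarkovEquiv M M') ∧
  (∀ M ∈ cls, ∀ a b, P.Adj a b ↔ M.Adj a b) ∧
  (∀ a b, P.mark a b = some Mark.arrow ↔ (P.Adj a b ∧ ∀ M ∈ cls, M.mark a b = some Mark.arrow)) ∧
  (∀ a b, P.mark a b = some Mark.tail ↔ (P.Adj a b ∧ ∀ M ∈ cls, M.mark a b = some Mark.tail))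

section Density

variable {Ω : Type} [Fintype V] [DecidableEq V] [Fintype Ω]

/-- `f` is a probability density (pmf) over the joint state space. -/
def IsDensity (f : (V → Ω) → ℝ) : Prop :=
  (∀ v, 0 ≤ f v) ∧ ∑ v, f v = 1

/-- The marginal density of the variables in `S`, evaluated at `v`. -/
noncomputable def margOn (f : (V → Ω) → ℝ) (S : Finset V) (v : V → Ω) : ℝ :=
  ∑ w : V → Ω, if ∀ i ∈ S, w i = v i then f w else 0

/-- The conditional density of the variables in `A` given those in `B`, at `v`. -/
noncomputable def condOn (f : (V → Ω) → ℝ) (A B : Finset V) (v : V → Ω) : ℝ :=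
  margOn f (A ∪ B) v / margOn f B v

/-- The parents of `i` in `G`. -/
noncomputable def parents (G : PMG V) (i : V) : Finset V :=
  Finset.univ.filter (fun j => G.DirEdge j i)

/-- `f` factorizes according to the DAG `G`. -/
def ConsistentWith (G : PMG V) (f : (V → Ω) → ℝ) : Prop :=
  ∀ v, f v = ∏ i, condOn f {i} (parents G i) v

/-- The post-intervention density `f(· | do(X = xval))` (truncated factorization). -/
noncomputable def doDens (G : PMG V) (f : (V → Ω) → ℝ) (X : Finset V) (xval : V → Ω) :
    (V → Ω) → ℝ :=
  fun v => if ∀ i ∈ X, v i = xval i then ∏ i ∈ Xᶜ, condOn f {i} (parents G i) v else 0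

/-- Overwrite `v` on `Z` by the assignment `w`. -/
noncomputable def patch (Z : Finset V) (v : V → Ω) (w : {i // i ∈ Z} → Ω) : V → Ω :=
  fun i => if h : i ∈ Z then w ⟨i, h⟩ else v i

end Density

/-- `Z` is an adjustment set relative to `(X,Y)` in the DAG `D`: for every finite state
space and every density consistent with `D`, the adjustment formula holds. -/
def IsAdjSetDAG [Fintype V] [DecidableEq V] (D : PMG V) (X Y Z : Finset V) : Prop :=
  ∀ (Ω : Type) [Fintype Ω] [DecidableEq Ω] (f : (V → Ω) → ℝ),
    IsDensity f → ConsistentWith D f →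
    ∀ v : V → Ω,
      margOn (doDens D f X v) Y v =
        if Z = ∅ then condOn f Y X v
        else ∑ w : ({i // i ∈ Z} → Ω),
          condOn f Y (X ∪ Z) (patch Z v w) * margOn f Z (patch Z v w)

/-- The marginal of a density over `V ⊕ L` on the observed variables `V`. -/
noncomputable def obsMargin {L : Type} [Fintype V] [Fintype L] [DecidableEq V] [DecidableEq L]
    {Ω : Type} [Fintype Ω] (f : ((V ⊕ L) → Ω) → ℝ) : (V → Ω) → ℝ :=
  fun v => ∑ w : (V ⊕ L) → Ω, if ∀ i : V, w (Sum.inl i) = v i then f w else 0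

/-- `M` is the MAG over the observed variables `V` of the DAG `D'` over `V ⊕ L`. -/
def IsMAGOverObs {L : Type} (D' : PMG (V ⊕ L)) (M : PMG V) : Prop :=
  (∀ a b : V, M.Adj a b ↔ (a ≠ b ∧ ∀ S : Finset V, a ∉ S → b ∉ S →
      ¬ MSep D' (Sum.inl a) (Sum.inl b) (S.image Sum.inl))) ∧
  (∀ a b : V, M.Adj a b →
    ((M.mark a b = some Mark.arrow ↔ ¬ Descendant D' (Sum.inl b) (Sum.inl a)) ∧
     (M.mark a b = some Mark.tail ↔ Descendant D' (Sum.inl b) (Sum.inl a))))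

/-- `Z` is an adjustment set relative to `(X,Y)` in the MAG `M`: for every DAG `D'`
with latent variables whose MAG over `V` is `M` and every consistent density,
the adjustment formula holds for the observed margin. -/
def IsAdjSetMAG [Fintype V] [DecidableEq V] (M : PMG V) (X Y Z : Finset V) : Prop :=
  ∀ (Ω L : Type) [Fintype Ω] [DecidableEq Ω] [Fintype L] [DecidableEq L]
    (D' : PMG (V ⊕ L)) (f' : ((V ⊕ L) → Ω) → ℝ),
    IsDAG D' → IsMAGOverObs D' M → IsDensity f' → ConsistentWith D' f' →
    ∀ v : (V ⊕ L) → Ω,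
      margOn (obsMargin (doDens D' f' (X.image Sum.inl) v)) Y (fun i => v (Sum.inl i)) =
        if Z = ∅ then condOn (obsMargin f') Y X (fun i => v (Sum.inl i))
        else ∑ w : ({i // i ∈ Z} → Ω),
          condOn (obsMargin f') Y (X ∪ Z) (patch Z (fun i => v (Sum.inl i)) w) *
            margOn (obsMargin f') Z (patch Z (fun i => v (Sum.inl i)) w)

/-- The distance-from-`Z` of a node `q`: the length of a shortest directed path
(possibly of length 0) from `q` to a member of `Z`. -/
noncomputable def distZ (G : PMG V) (Z : Finset V) (q : V) : ℕ :=
  sInf { n | ∃ p, IsPath G p ∧ DirectedAlong G p ∧ p.head? = some q ∧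
      (∃ z ∈ Z, p.getLast? = some z) ∧ p.length = n + 1 }

/-- The distance-from-`Z` of a path `p`: the sum of the distances-from-`Z`
of the colliders on `p`. -/
noncomputable def pathDistZ (G : PMG V) (Z : Finset V) (p : List V) : ℕ :=
  ∑ i ∈ Finset.range p.length,
    if ColliderAt G p i then (p[i+1]?.elim 0 (distZ G Z)) else 0

end PMG

namespace PMG

variable {V : Type}

/-! ### Basic facts -/

/-- there is an arrowhead at `b` on the edge between `a` and `b`. -/
def Arr (G : PMG V) (a b : V) : Prop := G.mark a b = some Mark.arrow

theorem Arr.adj {G : PMG V} {a b : V} (h : G.Arr a b) : G.Adj a b := by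
  unfold Arr at h; unfold Adj; simp [h]

theorem Adj.symm {G : PMG V} {a b : V} (h : G.Adj a b) : G.Adj b a := (G.symm a b).1 h

theorem Adj.ne {G : PMG V} {a b : V} (h : G.Adj a b) : a ≠ b := by
  rintro rfl; unfold Adj at h; rw [G.irrefl] at h; simp at h

theorem Arr.ne {G : PMG V} {a b : V} (h : G.Arr a b) : a ≠ b := h.adj.ne

theorem DirEdge.arr {G : PMG V} {a b : V} (h : G.DirEdge a b) : G.Arr a b := h.1

theorem DirEdge.not_arr {G : PMG V} {a b : V} (h : G.DirEdge a b) : ¬ G.Arr b a := by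
  unfold Arr; rw [h.2]; simp

theorem DirEdge.adj {G : PMG V} {a b : V} (h : G.DirEdge a b) : G.Adj a b := h.arr.adj

theorem DirEdge.ne {G : PMG V} {a b : V} (h : G.DirEdge a b) : a ≠ b := h.adj.ne

theorem IsMixed.dir_of_not_arr {G : PMG V} (hm : IsMixed G) {a b : V} (h : G.Adj a b)
    (hn : ¬ G.Arr b a) : G.DirEdge a b := by
  rcases hm a b h with h1 | h1 | h1
  · exact h1
  · exact absurd h1.1 hn
  · exact absurd h1.2 hn

/-- Ancestrality in terms of transitive closures. -/
structure Anc (G : PMG V) : Prop where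
  mixed : IsMixed G
  acyc : ∀ a, ¬ Relation.TransGen G.DirEdge a a
  almost : ∀ a b, Relation.TransGen G.DirEdge a b → ¬ G.BidirEdge b a

theorem desc_of_rtg {G : PMG V} {a b : V} (h : Relation.ReflTransGen G.DirEdge a b) :
    Descendant G a b := by
  induction h using Relation.ReflTransGen.head_induction_on with
  | refl =>
    refine ⟨[b], ⟨by simp, by simp, List.isChain_singleton _⟩, ?_, by simp, by simp⟩
    intro i u v h1 h2
    simp at h2
  | head hac hcb ih =>
    rename_i a c
    obtain ⟨q, ⟨hq0, hqn, hqc⟩, hqd, hqh, hql⟩ := ih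
    by_cases ha : a ∈ q
    · obtain ⟨l1, l2, rfl⟩ := List.append_of_mem ha
      refine ⟨a :: l2, ⟨by simp, (List.nodup_append.1 hqn).2.1, ?_⟩, ?_, by simp, ?_⟩
      · exact (List.isChain_append.1 hqc).2.1
      · intro i u v h1 h2
        apply hqd (l1.length + i) u v
        · rw [List.getElem?_append_right (by omega)]; simpa using h1
        · rw [List.getElem?_append_right (by omega)]
          rw [show l1.length + i + 1 - l1.length = i + 1 by omega]; exact h2
      · rw [List.getLast?_append] at hql
        simpa using hql
    · obtain ⟨d, l, rfl⟩ := List.exists_cons_of_ne_nil hq0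
      simp at hqh; subst hqh
      refine ⟨a :: d :: l, ⟨by simp, List.nodup_cons.2 ⟨ha, hqn⟩, ?_⟩, ?_, by simp, ?_⟩
      · exact List.isChain_cons_cons.2 ⟨hac.adj, hqc⟩
      · intro i u v h1 h2
        cases i with
        | zero => simp at h1 h2; subst h1; subst h2; exact hac
        | succ i => exact hqd i u v (by simpa using h1) (by simpa using h2)
      · simpa using hql

theorem rtg_of_desc {G : PMG V} {a b : V} (h : Descendant G a b) :
    Relation.ReflTransGen G.DirEdge a b := by
  obtain ⟨q, hq, hqd, hqh, hql⟩ := h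
  clear hq
  induction q generalizing a with
  | nil => simp at hqh
  | cons c l ih =>
    simp at hqh; subst hqh
    cases l with
    | nil => simp at hql; subst hql; exact Relation.ReflTransGen.refl
    | cons d l =>
      refine Relation.ReflTransGen.head (hqd 0 c d (by simp) (by simp)) (ih ?_ (by simp) (by simpa using hql))
      intro i u v h1 h2
      exact hqd (i+1) u v (by simpa using h1) (by simpa using h2)

theorem desc_iff {G : PMG V} {a b : V} :
    Descendant G a b ↔ Relation.ReflTransGen G.DirEdge a b := ⟨rtg_of_desc, desc_of_rtg⟩

theorem anc_iff {G : PMG V} : IsAncestral G ↔ Anc G := by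
  constructor
  · rintro ⟨hm, h1, h2⟩
    refine ⟨hm, ?_, ?_⟩
    · intro a h
      obtain ⟨c, hac, hca⟩ := Relation.TransGen.head'_iff.1 h
      have := h1 a c (desc_of_rtg (Relation.ReflTransGen.single hac)) (desc_of_rtg hca)
      exact hac.ne this
    · intro a b h
      exact h2 a b (desc_of_rtg h.to_reflTransGen)
  · intro h
    refine ⟨h.mixed, ?_, ?_⟩
    · intro a b h1 h2
      rcases (Relation.reflTransGen_iff_eq_or_transGen.1 (rtg_of_desc h1)) with h3 | h3
      · exact h3.symm
      · exact absurd (h3.trans_left (rtg_of_desc h2)) (h.acyc a)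
    · intro a b h1 h2
      rcases (Relation.reflTransGen_iff_eq_or_transGen.1 (rtg_of_desc h1)) with h3 | h3
      · subst h3; exact Arr.ne (G := G) h2.1 rfl
      · exact h.almost a b h3 h2

/-- `a → b *→ c` with `a`, `c` adjacent gives `a *→ c`. -/
theorem Anc.r2a {G : PMG V} (h : Anc G) {a b c : V} (hab : G.DirEdge a b) (hbc : G.Arr b c)
    (hac : G.Adj a c) : G.Arr a c := by
  by_contra hn
  have hca := h.mixed.dir_of_not_arr hac.symm hn
  have hcb : Relation.TransGen G.DirEdge c b := (Relation.TransGen.single hca).tail hab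
  rcases h.mixed b c hbc.adj with h1 | h1 | h1
  · exact h.acyc c (hcb.tail h1)
  · exact h1.not_arr hbc
  · exact h.almost c b hcb h1

/-- `a *→ b → c` with `a`, `c` adjacent gives `a *→ c`. -/
theorem Anc.r2b {G : PMG V} (h : Anc G) {a b c : V} (hab : G.Arr a b) (hbc : G.DirEdge b c)
    (hac : G.Adj a c) : G.Arr a c := by
  by_contra hn
  have hca := h.mixed.dir_of_not_arr hac.symm hn
  have hcb : Relation.TransGen G.DirEdge b a := (Relation.TransGen.single hbc).tail hca
  rcases h.mixed a b hab.adj with h1 | h1 | h1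
  · exact h.acyc b (hcb.tail h1)
  · exact h1.not_arr hab
  · exact h.almost b a hcb h1

/-- `a → b → c` with `a`, `c` adjacent gives `a → c`. -/
theorem Anc.r2c {G : PMG V} (h : Anc G) {a b c : V} (hab : G.DirEdge a b) (hbc : G.DirEdge b c)
    (hac : G.Adj a c) : G.DirEdge a c := by
  have hx : Relation.TransGen G.DirEdge a c := (Relation.TransGen.single hab).tail hbc
  rcases h.mixed a c hac with h1 | h1 | h1
  · exact h1
  · exact absurd (hx.tail h1) (h.acyc a)
  · exact absurd ⟨h1.2, h1.1⟩ (h.almost a c hx)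

/-! ### Walks as sequences of darts -/

/-- the triple `u, v, w` is open at `v` given `Z` (strict version). -/
def Tri (G : PMG V) (Z : Finset V) (u v w : V) : Prop :=
  G.Adj u v ∧ G.Adj v w ∧ (v ∈ Z ↔ (G.Arr u v ∧ G.Arr w v))

theorem Tri.symm {G : PMG V} {Z : Finset V} {u v w : V} (h : Tri G Z u v w) : Tri G Z w v u :=
  ⟨h.2.1.symm, h.1.symm, by rw [h.2.2]; exact and_comm⟩

/-- `DW G Z n a v u w`: a walk starting with the edge `a v` and ending with the edge `u w`,
all of whose `n` inner triples are open. -/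
inductive DW (G : PMG V) (Z : Finset V) : ℕ → V → V → V → V → Prop
  | refl (a v : V) (h : G.Adj a v) : DW G Z 0 a v a v
  | snoc {n : ℕ} {a v D E q : V} (h : DW G Z n a v D E) (t : Tri G Z D E q) : DW G Z (n+1) a v E q

theorem DW.append {G : PMG V} {Z : Finset V} {n m : ℕ} {a v u w x y : V}
    (h1 : DW G Z n a v u w) (h2 : DW G Z m u w x y) : DW G Z (n+m) a v x y := by
  induction h2 with
  | refl => exact h1
  | snoc _ t ih => exact (ih h1).snoc t

theorem DW.adj_last {G : PMG V} {Z : Finset V} {n : ℕ} {a v x y : V}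
    (h : DW G Z n a v x y) : G.Adj x y := by
  cases h with
  | refl _ _ h => exact h
  | snoc _ t => exact t.2.1

theorem Tri.dw {G : PMG V} {Z : Finset V} {u v w : V} (t : Tri G Z u v w) :
    DW G Z 1 u v v w := (DW.refl u v t.1).snoc t

theorem DW.rev {G : PMG V} {Z : Finset V} {n : ℕ} {a v x y : V}
    (h : DW G Z n a v x y) : DW G Z n y x v a := by
  induction h with
  | refl _ _ h => exact DW.refl _ _ h.symm
  | snoc _ t ih =>
    rename_i n _ _ _ _ _ _
    have := t.symm.dw.append ih
    rwa [Nat.add_comm] at this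

theorem DW.snoc_inv {G : PMG V} {Z : Finset V} {n : ℕ} {a v x y : V}
    (h : DW G Z (n+1) a v x y) : ∃ D, DW G Z n a v D x ∧ Tri G Z D x y := by
  cases h with
  | snoc h t => exact ⟨_, h, t⟩

theorem DW.cons_inv {G : PMG V} {Z : Finset V} {n : ℕ} {a v x y : V}
    (h : DW G Z (n+1) a v x y) : ∃ H, Tri G Z a v H ∧ DW G Z n v H x y := by
  obtain ⟨D, h1, t⟩ := h.rev.snoc_inv
  exact ⟨D, t.symm, h1.rev⟩

theorem DW.zero_inv {G : PMG V} {Z : Finset V} {a v x y : V}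
    (h : DW G Z 0 a v x y) : a = x ∧ v = y := by
  cases h; exact ⟨rfl, rfl⟩

/-- `a` and `b` are connected by an open walk. -/
def WConn (G : PMG V) (Z : Finset V) (a b : V) : Prop := ∃ n v w, DW G Z n a v w b

theorem WConn.symm {G : PMG V} {Z : Finset V} {a b : V} (h : WConn G Z a b) : WConn G Z b a := by
  obtain ⟨n, v, w, h⟩ := h
  exact ⟨n, w, v, h.rev⟩

/-- Going down to `Z` and back. -/
theorem DW.down {G : PMG V} {Z : Finset V} {v z : V}
    (h : Relation.ReflTransGen G.DirEdge v z) (hz : z ∈ Z) (hv : v ∉ Z) :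
    ∃ n c, G.DirEdge v c ∧ DW G Z n v c c v := by
  induction h using Relation.ReflTransGen.head_induction_on with
  | refl => exact absurd hz hv
  | head hac hcb ih =>
    rename_i a c
    by_cases hc : c ∈ Z
    · exact ⟨1, c, hac, Tri.dw ⟨hac.adj, hac.adj.symm, by simp [hc, hac.arr]⟩⟩
    · obtain ⟨n, d, hcd, hw⟩ := ih hc
      have t : Tri G Z a c d := ⟨hac.adj, hcd.adj, by simp [hc, hcd.not_arr]⟩
      exact ⟨_, c, hac, (t.dw.append hw).snoc t.symm⟩

/-- the triple `u, v, w` is open at `v` given `Z` (ancestor version). -/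
def ATri (G : PMG V) (Z : Finset V) (u v w : V) : Prop :=
  G.Adj u v ∧ G.Adj v w ∧ (¬ (G.Arr u v ∧ G.Arr w v) → v ∉ Z) ∧
    ((G.Arr u v ∧ G.Arr w v) → ∃ z ∈ Z, Relation.ReflTransGen G.DirEdge v z)

theorem Tri.atri {G : PMG V} {Z : Finset V} {u v w : V} (h : Tri G Z u v w) : ATri G Z u v w :=
  ⟨h.1, h.2.1, fun hn hv => hn (h.2.2.1 hv), fun hc => ⟨v, h.2.2.2 hc, Relation.ReflTransGen.refl⟩⟩

/-- all successive triples on the list are open. -/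
def AOK (G : PMG V) (Z : Finset V) : List V → Prop
  | [] => True
  | [_] => True
  | [u, v] => G.Adj u v
  | u :: v :: w :: l => ATri G Z u v w ∧ AOK G Z (v :: w :: l)

theorem AOK.adj {G : PMG V} {Z : Finset V} {u v : V} {l : List V} (h : AOK G Z (u :: v :: l)) :
    G.Adj u v := by
  cases l with
  | nil => exact h
  | cons w l => exact h.1.1

theorem AOK.tail {G : PMG V} {Z : Finset V} {u : V} {l : List V} (h : AOK G Z (u :: l)) :
    AOK G Z l := by
  match l, h with
  | [], _ => trivial
  | [_], _ => trivial
  | _ :: _ :: _, h => exact h.2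

theorem AOK.suffix {G : PMG V} {Z : Finset V} {l1 l2 : List V} (h : AOK G Z (l1 ++ l2)) :
    AOK G Z l2 := by
  induction l1 with
  | nil => exact h
  | cons a l ih => exact ih h.tail

theorem AOK.glue {G : PMG V} {Z : Finset V} {u n w : V} {l1 l2 l3 : List V}
    (h1 : AOK G Z (l1 ++ u :: n :: l2)) (ht : ATri G Z u n w) (h2 : AOK G Z (n :: w :: l3)) :
    AOK G Z (l1 ++ u :: n :: w :: l3) := by
  induction l1 with
  | nil => exact ⟨ht, h2⟩
  | cons a l ih =>
    have h3 := ih h1.tail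
    match l, h1, h3 with
    | [], h1, h3 => exact ⟨h1.1, h3⟩
    | [b], h1, h3 => exact ⟨h1.1, h3⟩
    | b :: c :: l, h1, h3 => exact ⟨h1.1, h3⟩

theorem AOK.initSeg {G : PMG V} {Z : Finset V} {l1 l2 : List V}
    (h1 : AOK G Z (l1 ++ l2)) : AOK G Z l1 := by
  induction l1 with
  | nil => trivial
  | cons a l ih =>
    have h3 := ih h1.tail
    match l, h1, h3 with
    | [], h1, h3 => trivial
    | [b], h1, h3 => exact h1.adj
    | b :: c :: l, h1, h3 => exact ⟨h1.1, h3⟩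

/-- middle triple of a list. -/
theorem AOK.mid {G : PMG V} {Z : Finset V} {u v w : V} {l1 l2 : List V}
    (h1 : AOK G Z (l1 ++ u :: v :: w :: l2)) : ATri G Z u v w := h1.suffix.1

/-- Following a directed edge along an open walk. -/
theorem AOK.follow {G : PMG V} {Z : Finset V} {x y b : V} {l : List V}
    (h : AOK G Z (x :: y :: l)) (hxy : G.DirEdge x y) (hm : IsMixed G)
    (hl : (y :: l).getLast? = some b) :
    (∃ z ∈ Z, Relation.ReflTransGen G.DirEdge x z) ∨ Relation.TransGen G.DirEdge x b := by
  induction l generalizing x y with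
  | nil => simp at hl; subst hl; exact Or.inr (Relation.TransGen.single hxy)
  | cons w l ih =>
    by_cases hw : G.Arr w y
    · obtain ⟨z, hz, hyz⟩ := h.1.2.2.2 ⟨hxy.arr, hw⟩
      exact Or.inl ⟨z, hz, Relation.ReflTransGen.head hxy hyz⟩
    · have hyw := hm.dir_of_not_arr h.1.2.1 hw
      rcases ih h.2 hyw (by simpa using hl) with ⟨z, hz, h3⟩ | h3
      · exact Or.inl ⟨z, hz, Relation.ReflTransGen.head hxy h3⟩
      · exact Or.inr (Relation.TransGen.head hxy h3)

theorem dw_list {G : PMG V} {Z : Finset V} {n : ℕ} {a v w b : V} (h : DW G Z n a v w b) :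
    ∃ l : List V, AOK G Z (a :: v :: l) ∧ (v :: l).getLast? = some b := by
  induction n generalizing a v with
  | zero =>
    obtain ⟨rfl, rfl⟩ := h.zero_inv
    exact ⟨[], h.adj_last, by simp⟩
  | succ n ih =>
    obtain ⟨H, t, h2⟩ := h.cons_inv
    obtain ⟨l, h3, h4⟩ := ih h2
    exact ⟨H :: l, ⟨t.atri, h3⟩, by simpa using h4⟩

theorem exists_nodup_walk {G : PMG V} (hG : Anc G) {Z : Finset V} {a b : V} (hab : a ≠ b)
    (h : WConn G Z a b) :
    ∃ p : List V, AOK G Z p ∧ p.Nodup ∧ p.head? = some a ∧ p.getLast? = some b := by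
  have hex : ∃ k, ∃ p : List V, p.length = k ∧ AOK G Z p ∧ p.head? = some a ∧ p.getLast? = some b := by
    obtain ⟨n, v, w, h⟩ := h
    obtain ⟨l, h1, h2⟩ := dw_list h
    exact ⟨_, a :: v :: l, rfl, h1, by simp, by simpa using h2⟩
  classical
  obtain ⟨p, hlen, hok, hh, hl⟩ := Nat.find_spec hex
  have hmin := fun m => Nat.find_min hex (m := m)
  refine ⟨p, hok, ?_, hh, hl⟩
  by_contra hnd
  rw [← List.exists_duplicate_iff_not_nodup] at hnd
  obtain ⟨n, hn⟩ := hnd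
  -- split the list
  have hsplit : ∃ l1 l2 l3, p = l1 ++ n :: (l2 ++ n :: l3) := by
    obtain ⟨i, j, hi, hj⟩ := List.duplicate_iff_exists_distinct_get.1 hn
    have hcount : [n, n].Sublist p := List.duplicate_iff_sublist.1 hn
    obtain ⟨r1, r2, rfl, h1, h2⟩ := List.cons_sublist_iff.1 hcount
    have hm2 : n ∈ r2 := by simpa using h2
    obtain ⟨s1, s2, rfl⟩ := List.append_of_mem h1
    obtain ⟨t1, t2, rfl⟩ := List.append_of_mem hm2
    exact ⟨s1, s2 ++ t1, t2, by simp⟩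
  obtain ⟨l1, l2, l3, rfl⟩ := hsplit
  refine hmin (l1 ++ n :: l3).length ?_ ⟨l1 ++ n :: l3, rfl, ?_, ?_, ?_⟩
  · rw [← hlen]; simp
  · have hs2 : AOK G Z (n :: l3) := by
      have : l1 ++ n :: (l2 ++ n :: l3) = (l1 ++ n :: l2) ++ (n :: l3) := by simp
      rw [this] at hok; exact hok.suffix
    rcases List.eq_nil_or_concat l1 with rfl | ⟨l1', u, rfl⟩
    · exact hs2
    · simp only [List.concat_eq_append] at hok ⊢
      cases l3 with
      | nil =>
        have : l1' ++ [u] ++ n :: (l2 ++ [n]) = (l1' ++ [u] ++ [n]) ++ (l2 ++ [n]) := by simp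
        rw [this] at hok; exact hok.initSeg
      | cons w l3 =>
        have e1 : l1' ++ [u] ++ n :: (l2 ++ n :: w :: l3) = l1' ++ u :: n :: (l2 ++ n :: w :: l3) := by simp
        rw [e1] at hok
        have e2 : l1' ++ [u] ++ n :: w :: l3 = l1' ++ u :: n :: w :: l3 := by simp
        rw [e2]
        refine hok.glue ?_ hs2
        -- the first and last inner nodes
        cases l2 with
        | nil => exact absurd rfl (hok.suffix.tail.adj.ne)
        | cons c l2 =>
          have t1 : ATri G Z u n c := AOK.mid (l1 := l1') (l2 := l2 ++ n :: w :: l3) (by simpa using hok)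
          obtain ⟨l2', d, hd⟩ : ∃ l2' d, c :: l2 = l2' ++ [d] := by
            rcases List.eq_nil_or_concat (c :: l2) with h | ⟨l, d, h⟩
            · simp at h
            · exact ⟨l, d, by simpa using h⟩
          have t2 : ATri G Z d n w := by
            refine AOK.mid (l1 := l1' ++ u :: n :: l2') (l2 := l3) ?_
            rw [hd] at hok; simpa using hok
          refine ⟨t1.1, t2.2.1, ?_, ?_⟩
          · intro hnc
            by_cases hu : G.Arr u n
            · exact t2.2.2.1 (fun h => hnc ⟨hu, h.2⟩)
            · exact t1.2.2.1 (fun h => hu h.1)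
          · rintro ⟨hu, hw⟩
            by_cases hc : G.Arr c n
            · exact t1.2.2.2 ⟨hu, hc⟩
            · have hnc := hG.mixed.dir_of_not_arr t1.2.1 hc
              have hseg : AOK G Z (n :: c :: (l2 ++ [n])) := by
                have e3 : l1' ++ u :: n :: (c :: l2 ++ n :: w :: l3)
                    = (l1' ++ [u]) ++ ((n :: c :: (l2 ++ [n])) ++ (w :: l3)) := by simp
                rw [e3] at hok
                exact hok.suffix.initSeg
              rcases hseg.follow hnc hG.mixed (b := n)
                (by rw [← List.cons_append, List.getLast?_append]; simp) with h | h
              · exact h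
              · exact absurd h (hG.acyc n)
  · cases l1 <;> simpa using hh
  · rw [List.getLast?_append] at hl ⊢
    rw [← List.cons_append, List.getLast?_append] at hl
    simpa using hl

theorem AOK.get {G : PMG V} {Z : Finset V} {p : List V} (h : AOK G Z p) :
    ∀ i u v w, p[i]? = some u → p[i+1]? = some v → p[i+2]? = some w → ATri G Z u v w := by
  induction p with
  | nil => intro i u v w h1; simp at h1
  | cons a l ih =>
    intro i u v w h1 h2 h3
    cases i with
    | zero =>
      match l, h, h1, h2, h3 with
      | [], _, _, h2, _ => simp at h2
      | [_], _, _, _, h3 => simp at h3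
      | b :: c :: l, h, h1, h2, h3 =>
        simp at h1 h2 h3; subst h1; subst h2; subst h3; exact h.1
    | succ i => exact ih h.tail i u v w (by simpa using h1) (by simpa using h2) (by simpa using h3)

theorem AOK.chain {G : PMG V} {Z : Finset V} {p : List V} (h : AOK G Z p) : p.IsChain G.Adj := by
  induction p with
  | nil => exact List.isChain_nil
  | cons a l ih =>
    cases l with
    | nil => exact List.isChain_singleton _
    | cons b l => exact List.isChain_cons_cons.2 ⟨h.adj, ih h.tail⟩

theorem AOK.of_get {G : PMG V} {Z : Finset V} {p : List V} (hc : p.IsChain G.Adj)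
    (h : ∀ i u v w, p[i]? = some u → p[i+1]? = some v → p[i+2]? = some w → ATri G Z u v w) :
    AOK G Z p := by
  induction p with
  | nil => trivial
  | cons a l ih =>
    have hl : AOK G Z l := by
      refine ih hc.tail ?_
      intro i u v w h1 h2 h3
      exact h (i+1) u v w (by simpa using h1) (by simpa using h2) (by simpa using h3)
    match l, hc, h, hl with
    | [], _, _, _ => trivial
    | [b], hc, _, _ => exact (List.isChain_cons_cons.1 hc).1
    | b :: c :: l, hc, h, hl => exact ⟨h 0 a b c (by simp) (by simp) (by simp), hl⟩

theorem AOK.wconn {G : PMG V} {Z : Finset V} {a v b : V} {l : List V} (h : AOK G Z (a :: v :: l))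
    (hl : (v :: l).getLast? = some b) : ∃ n w, DW G Z n a v w b := by
  induction l generalizing a v with
  | nil => simp at hl; subst hl; exact ⟨0, a, DW.refl _ _ h⟩
  | cons w l ih =>
    obtain ⟨n, c, h1⟩ := ih h.2 (by simpa using hl)
    obtain ⟨ha, hb, h2, h3⟩ := h.1
    by_cases hc : G.Arr a v ∧ G.Arr w v
    · by_cases hz : v ∈ Z
      · have t : Tri G Z a v w := ⟨ha, hb, by simp [hz, hc]⟩
        exact ⟨_, c, t.dw.append h1⟩
      · obtain ⟨z, hz1, hz2⟩ := h3 hc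
        obtain ⟨m, d, hd, hw⟩ := DW.down hz2 hz1 hz
        have t1 : Tri G Z a v d := ⟨ha, hd.adj, by simp [hz, hd.not_arr]⟩
        have t2 : Tri G Z d v w := ⟨hd.adj.symm, hb, by simp [hz, hd.not_arr]⟩
        exact ⟨_, c, (t1.dw.append hw).append (t2.dw.append h1)⟩
    · have t : Tri G Z a v w := ⟨ha, hb, by simp [hc, h2 hc]⟩
      exact ⟨_, c, t.dw.append h1⟩

/-- m-separation in terms of open walks. -/
theorem msep_iff {G : PMG V} (hG : Anc G) {Z : Finset V} {a b : V} (hab : a ≠ b) :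
    MSep G a b Z ↔ ¬ WConn G Z a b := by
  constructor
  · intro hs hw
    obtain ⟨p, hok, hnd, hh, hl⟩ := exists_nodup_walk hG hab hw
    have hlen : 2 ≤ p.length := by
      match p, hh, hl with
      | [], hh, _ => simp at hh
      | [c], hh, hl => simp at hh hl; exact absurd (hh.symm.trans hl) hab
      | _ :: _ :: _, _, _ => simp
    refine hs p ⟨⟨?_, hnd, hok.chain⟩, hh, hl, hlen⟩ ⟨?_, ?_, ?_⟩
    · rintro rfl; simp at hlen
    · intro i hi
      have e1 : p[i]? = some p[i] := List.getElem?_eq_getElem _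
      have e2 : p[i+1]? = some p[i+1] := List.getElem?_eq_getElem _
      have e3 : p[i+2]? = some p[i+2] := List.getElem?_eq_getElem _
      have t := hok.get i _ _ _ e1 e2 e3
      by_cases h1 : G.Arr p[i] p[i+1]
      · by_cases h2 : G.Arr p[i+2] p[i+1]
        · exact Or.inl ⟨_, _, _, e1, e2, e3, h1, h2⟩
        · exact Or.inr ⟨_, _, _, e1, e2, e3, Or.inr (Or.inl (hG.mixed.dir_of_not_arr t.2.1 h2).2)⟩
      · exact Or.inr ⟨_, _, _, e1, e2, e3, Or.inl (hG.mixed.dir_of_not_arr t.1.symm h1).2⟩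
    · rintro i b' hb' ⟨u, v, w, h1, h2, h3, h4⟩
      have t := hok.get i _ _ _ h1 h2 h3
      rw [hb'] at h2; simp at h2; subst h2
      refine t.2.2.1 ?_
      rintro ⟨g1, g2⟩
      unfold Arr at g1 g2
      rw [g1, g2] at h4; simp at h4
    · rintro i b' hb' ⟨u, v, w, h1, h2, h3, h4, h5⟩
      have t := hok.get i _ _ _ h1 h2 h3
      rw [hb'] at h2; simp at h2; subst h2
      obtain ⟨z, hz, hz2⟩ := t.2.2.2 ⟨h4, h5⟩
      exact ⟨z, hz, desc_of_rtg hz2⟩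
  · rintro hw p ⟨⟨hne, hnd, hch⟩, hh, hl, hlen⟩ ⟨_, hnc, hcol⟩
    have hok : AOK G Z p := by
      refine AOK.of_get hch ?_
      intro i u v w h1 h2 h3
      have hu : G.Adj u v := by
        have := List.isChain_iff_getElem.1 hch i (by
          have := (List.getElem?_eq_some_iff.1 h2).1; omega)
        obtain ⟨_, rfl⟩ := List.getElem?_eq_some_iff.1 h1
        obtain ⟨_, rfl⟩ := List.getElem?_eq_some_iff.1 h2
        exact this
      have hv : G.Adj v w := by
        have := List.isChain_iff_getElem.1 hch (i+1) (by
          have := (List.getElem?_eq_some_iff.1 h3).1; omega)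
        obtain ⟨_, rfl⟩ := List.getElem?_eq_some_iff.1 h2
        obtain ⟨_, rfl⟩ := List.getElem?_eq_some_iff.1 h3
        exact this
      refine ⟨hu, hv, ?_, ?_⟩
      · intro hn
        refine hnc i v h2 ⟨u, v, w, h1, h2, h3, ?_⟩
        by_cases g1 : G.Arr u v
        · have g2 : ¬ G.Arr w v := fun g => hn ⟨g1, g⟩
          exact Or.inr (Or.inl (hG.mixed.dir_of_not_arr hv g2).2)
        · exact Or.inl (hG.mixed.dir_of_not_arr hu.symm g1).2
      · intro hc
        obtain ⟨z, hz, hz2⟩ := hcol i v h2 ⟨u, v, w, h1, h2, h3, hc.1, hc.2⟩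
        exact ⟨z, hz, rtg_of_desc hz2⟩
    match p, hok, hh, hl, hlen with
    | [], _, _, _, hlen => simp at hlen
    | [_], _, _, _, hlen => simp at hlen
    | c :: v :: l, hok, hh, hl, _ =>
      simp at hh; subst hh
      obtain ⟨n, w, h⟩ := hok.wconn (b := b) (by simpa using hl)
      exact hw ⟨n, v, w, h⟩

end PMG
namespace PMG

variable {V : Type}

/-! ### Adding nodes to separating sets -/

theorem add_aux1 {G : PMG V} {Z : Finset V} {B C : V} (hBZ : B ∉ Z) (hBC : G.DirEdge B C)
    (hC : C ∈ Z) {n : ℕ} {a v u w : V} (h : DW G (insert B Z) n a v u w) :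
    ∃ m, DW G Z m a v u w := by
  induction h with
  | refl a v h => exact ⟨0, DW.refl _ _ h⟩
  | snoc h t ih =>
    rename_i n a v D E q
    obtain ⟨m, hm⟩ := ih
    by_cases hE : E = B
    · subst hE
      have t1 : Tri G Z D E C := ⟨t.1, hBC.adj, by simp [hBZ, hBC.not_arr]⟩
      have t2 : Tri G Z E C E := ⟨hBC.adj, hBC.adj.symm, by simp [hC, hBC.arr]⟩
      have t3 : Tri G Z C E q := ⟨hBC.adj.symm, t.2.1, by simp [hBZ, hBC.not_arr]⟩
      exact ⟨_, ((hm.snoc t1).snoc t2).snoc t3⟩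
    · exact ⟨_, hm.snoc ⟨t.1, t.2.1, by rw [← t.2.2]; simp [hE]⟩⟩

theorem add_aux2 {G : PMG V} {Z : Finset V} {B a : V} (hBZ : B ∉ Z) (hBC : G.DirEdge B a)
    {n : ℕ} {v u w : V} (h : DW G (insert B Z) n a v u w) :
    ∃ m v', DW G Z m a v' u w := by
  induction h with
  | refl a v h => exact ⟨0, v, DW.refl _ _ h⟩
  | snoc h t ih =>
    rename_i n a v D E q
    obtain ⟨m, v', hm⟩ := ih hBC
    by_cases hE : E = B
    · subst hE
      have t1 : Tri G Z a E q := ⟨hBC.adj.symm, t.2.1, by simp [hBZ, hBC.not_arr]⟩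
      exact ⟨_, _, t1.dw⟩
    · exact ⟨_, _, hm.snoc ⟨t.1, t.2.1, by rw [← t.2.2]; simp [hE]⟩⟩

theorem add_lemma {G : PMG V} {Z : Finset V} {B C D E : V} (hs : ¬ WConn G Z D E)
    (hBC : G.DirEdge B C) (hC : C ∈ Z ∨ C = D ∨ C = E) : ¬ WConn G (insert B Z) D E := by
  by_cases hBZ : B ∈ Z
  · rwa [Finset.insert_eq_of_mem hBZ]
  rintro ⟨n, v, w, h⟩
  rcases hC with hC | rfl | rfl
  · obtain ⟨m, h⟩ := add_aux1 hBZ hBC hC h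
    exact hs ⟨_, _, _, h⟩
  · obtain ⟨m, v', h⟩ := add_aux2 hBZ hBC h
    exact hs ⟨_, _, _, h⟩
  · obtain ⟨m, v', h⟩ := add_aux2 hBZ hBC h.rev
    exact hs ⟨_, _, _, h.rev⟩

theorem excl_lemma {G : PMG V} {Z : Finset V} {B D E : V} (h1 : G.Arr D B) (h2 : G.Arr E B)
    (hB : B ∈ Z) : WConn G Z D E :=
  ⟨_, _, _, Tri.dw (v := B) ⟨h1.adj, h2.adj.symm, by simp [h1, h2, hB]⟩⟩

/-! ### Flipping one mark -/

/-- the side conditions for flipping the mark at `A` on the edge between `A` and `B`. -/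
structure FlipC (X : PMG V) (A B : V) (K : V → Prop) : Prop where
  arr : X.Arr A B
  kne : ∀ q, K q → q ≠ A ∧ q ≠ B
  k1 : ∀ E, E ≠ B → X.Arr E A → X.Arr E B ∧ (X.mark B E = X.mark A E ∨ K E)
  k2 : ∀ q E, K q → X.Arr E q → (E = A ∧ X.Arr q A) ∨
    (E ≠ A ∧ X.Arr E B ∧ (X.mark B E = X.mark q E ∨ K E))

theorem FlipC.surgery {X : PMG V} {A B : V} {K : V → Prop} (hX : FlipC X A B K) {Z : Finset V} :
    ∀ (n : ℕ) {a v E q : V}, DW X Z n a v E q → X.Arr E q → ((q = A ∧ E ≠ B) ∨ K q) →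
      ∃ n' ≤ n, ∃ v' E', DW X Z n' a v' E' B ∧ X.Arr E' B := by
  intro n
  induction n with
  | zero =>
    intro a v E q h hEq hq
    obtain ⟨rfl, rfl⟩ := h.zero_inv
    have hB : X.Arr a B := by
      rcases hq with ⟨rfl, hE⟩ | hq
      · exact (hX.k1 a hE hEq).1
      · rcases hX.k2 _ _ hq hEq with ⟨rfl, _⟩ | h2
        · exact hX.arr
        · exact h2.2.1
    exact ⟨0, le_rfl, B, a, DW.refl _ _ hB.adj, hB⟩
  | succ k ih =>
    intro a v E q h hEq hq
    obtain ⟨D, hD, t⟩ := h.snoc_inv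
    have gen : X.Arr E B → (X.mark B E = X.mark q E ∨ K E) →
        ∃ n' ≤ k + 1, ∃ v' E', DW X Z n' a v' E' B ∧ X.Arr E' B := by
      intro hEB hor
      by_cases hm : X.mark B E = X.mark q E
      · refine ⟨k+1, le_rfl, v, E, hD.snoc ⟨t.1, hEB.adj, ?_⟩, hEB⟩
        rw [t.2.2]; unfold Arr; rw [hm]
      · have hK : K E := hor.resolve_left hm
        by_cases hDE : X.Arr D E
        · obtain ⟨n', hn', v', E', h1, h2⟩ := ih hD hDE (Or.inr hK)
          exact ⟨n', by omega, v', E', h1, h2⟩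
        · have hZ : E ∉ Z := fun hE => hDE (t.2.2.1 hE).1
          exact ⟨k+1, le_rfl, v, E, hD.snoc ⟨t.1, hEB.adj, by simp [hZ, hDE]⟩, hEB⟩
    rcases hq with ⟨rfl, hE⟩ | hq
    · have h1 := hX.k1 E hE hEq
      exact gen h1.1 h1.2
    · rcases hX.k2 _ _ hq hEq with ⟨rfl, hqA⟩ | h2
      · by_cases hBA : X.Arr B E
        · refine ⟨k+1, le_rfl, v, E, hD.snoc ⟨t.1, hX.arr.adj, ?_⟩, hX.arr⟩
          rw [t.2.2]; simp [hqA, hBA]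
        · by_cases hDE : X.Arr D E
          · have hDB : D ≠ B := by rintro rfl; exact hBA hDE
            obtain ⟨n', hn', v', E', h1, h2⟩ := ih hD hDE (Or.inl ⟨rfl, hDB⟩)
            exact ⟨n', by omega, v', E', h1, h2⟩
          · have hZ : E ∉ Z := fun hE => hDE (t.2.2.1 hE).1
            exact ⟨k+1, le_rfl, v, E, hD.snoc ⟨t.1, hX.arr.adj, by simp [hZ, hDE]⟩, hX.arr⟩
      · exact gen h2.2.1 h2.2.2

theorem DW.head_change {X : PMG V} {Z : Finset V} {m : ℕ} {A B u w E : V}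
    (h : DW X Z m A B u w) (hA : X.Arr A B) (hE : X.Arr E B) :
    ∃ u', DW X Z m E B u' w := by
  cases m with
  | zero => obtain ⟨rfl, rfl⟩ := h.zero_inv; exact ⟨_, DW.refl _ _ hE.adj⟩
  | succ m =>
    obtain ⟨H, t, h2⟩ := h.cons_inv
    have t2 : Tri X Z E B H := ⟨hE.adj, t.2.1, by rw [t.2.2]; simp [hA, hE]⟩
    have := t2.dw.append h2
    rw [Nat.add_comm] at this
    exact ⟨_, this⟩

theorem DW.problem {X X' : PMG V} (hadj : ∀ a b, X.Adj a b → X'.Adj a b) {Z : Finset V}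
    {n : ℕ} {a v u w : V} (h : DW X Z n a v u w) :
    DW X' Z n a v u w ∨ ∃ k m c1 c2 c3, k + 1 + m = n ∧ DW X Z k a v c1 c2 ∧ Tri X Z c1 c2 c3 ∧
      ¬ Tri X' Z c1 c2 c3 ∧ DW X Z m c2 c3 u w := by
  induction h with
  | refl a v h => exact Or.inl (DW.refl _ _ (hadj _ _ h))
  | snoc h t ih =>
    rename_i n a v D E q
    rcases ih with ih | ⟨k, m, c1, c2, c3, hn, h1, h2, h3, h4⟩
    · by_cases ht : Tri X' Z D E q
      · exact Or.inl (ih.snoc ht)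
      · exact Or.inr ⟨n, 0, D, E, q, rfl, h, t, ht, DW.refl _ _ t.2.1⟩
    · exact Or.inr ⟨k, m+1, c1, c2, c3, by omega, h1, h2, h3, h4.snoc t⟩

theorem FlipC.conn {X X' : PMG V} {A B : V} {K : V → Prop} (hX : FlipC X A B K)
    (hadj : ∀ a b, X.Adj a b → X'.Adj a b)
    (hsame : ∀ a b, ¬ (a = B ∧ b = A) → X.mark a b = X'.mark a b)
    {Z : Finset V} {a b : V} (hab : a ≠ b) (h : WConn X Z a b) : WConn X' Z a b := by
  have hBA : A ≠ B := hX.arr.ne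
  have key : ∀ (n : ℕ) (a b v w : V), a ≠ b → DW X Z n a v w b → WConn X' Z a b := by
    intro n
    induction n using Nat.strong_induction_on with
    | _ n ih =>
    intro a b v w hab h
    have fix : ∀ {k m : ℕ} {a b v w C : V}, a ≠ b → k + 1 + m = n → DW X Z k a v C A → X.Arr C A →
        C ≠ B → DW X Z m A B w b → WConn X' Z a b := by
      intro k m a b v w C hab hn h1 hCA hCB h2
      obtain ⟨n', hn', v', E', h3, h4⟩ := hX.surgery k h1 hCA (Or.inl ⟨rfl, hCB⟩)
      obtain ⟨u', h5⟩ := h2.head_change hX.arr h4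
      exact ih (n' + m) (by omega) _ _ _ _ hab (h3.append h5)
    rcases h.problem hadj with h | ⟨k, m, c1, c2, c3, hn, h1, h2, h3, h4⟩
    · exact ⟨_, _, _, h⟩
    have hpr : c2 = A ∧ (c1 = B ∨ c3 = B) := by
      by_contra hcon
      refine h3 ⟨hadj _ _ h2.1, hadj _ _ h2.2.1, ?_⟩
      rw [h2.2.2]; unfold Arr
      rw [hsame c1 c2 (by tauto), hsame c3 c2 (by tauto)]
    obtain ⟨rfl, hpr⟩ := hpr
    by_cases hc1 : c1 = B
    · by_cases hc3 : c3 = B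
      · subst hc1; subst hc3
        -- delete the detour
        cases k with
        | zero =>
          obtain ⟨rfl, rfl⟩ := h1.zero_inv
          cases m with
          | zero => exact absurd h4.zero_inv.2 hab
          | succ m =>
            obtain ⟨H, t, h5⟩ := h4.cons_inv
            exact ih m (by omega) _ _ _ _ hab h5
        | succ k =>
          obtain ⟨H1, h6, t6⟩ := h1.snoc_inv
          cases m with
          | zero =>
            obtain ⟨rfl, rfl⟩ := h4.zero_inv
            exact ih k (by omega) _ _ _ _ hab h6
          | succ m =>
            obtain ⟨H, t, h5⟩ := h4.cons_inv
            have t7 : Tri X Z H1 c3 H := by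
              refine ⟨t6.1, t.2.1, ?_⟩
              have e1 := t6.2.2
              have e2 := t.2.2
              have := hX.arr
              tauto
            exact ih (k + (1 + m)) (by omega) _ _ _ _ hab (h6.append (t7.dw.append h5))
      · subst hc1
        have hC : X.Arr c3 c2 := by
          by_contra hC
          refine h3 ⟨hadj _ _ h2.1, hadj _ _ h2.2.1, ?_⟩
          rw [h2.2.2]
          have : ¬ X'.Arr c3 c2 := by
            unfold Arr at hC ⊢; rwa [← hsame c3 c2 (fun h => hc3 h.1)]
          tauto
        obtain h := fix (a := b) (b := a) hab.symm (by omega) h4.rev hC hc3 h1.rev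
        exact h.symm
    · have hc3 : c3 = B := hpr.resolve_left hc1
      subst hc3
      have hC : X.Arr c1 c2 := by
        by_contra hC
        refine h3 ⟨hadj _ _ h2.1, hadj _ _ h2.2.1, ?_⟩
        rw [h2.2.2]
        have : ¬ X'.Arr c1 c2 := by
          unfold Arr at hC ⊢; rwa [← hsame c1 c2 (fun h => hc1 h.1)]
        tauto
      exact fix hab hn h1 hC hc1 h4
  obtain ⟨n, v, w, h⟩ := h
  exact key n a b v w hab h

theorem FlipC.transfer {X X' : PMG V} {A B : V} {K : V → Prop} (hX : FlipC X A B K)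
    (hsame : ∀ a b, ¬ (a = B ∧ b = A) → X.mark a b = X'.mark a b) : FlipC X' A B K := by
  have hBA : A ≠ B := hX.arr.ne
  have hs' : ∀ a b, ¬ (a = B ∧ b = A) → (X'.Arr a b ↔ X.Arr a b) := by
    intro a b h; unfold Arr; rw [hsame a b h]
  refine ⟨(hs' _ _ (fun h => hBA h.1)).2 hX.arr, hX.kne, ?_, ?_⟩
  · intro E hE hEA
    have hEA' := (hs' _ _ (fun h => hE h.1)).1 hEA
    obtain ⟨h1, h2⟩ := hX.k1 E hE hEA'
    refine ⟨(hs' _ _ (fun h => hE h.1)).2 h1, ?_⟩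
    rwa [hsame B E (fun h => hEA'.ne h.2), hsame A E (fun h => hBA h.1)] at h2
  · intro q E hq hEq
    have hne := hX.kne q hq
    rcases hX.k2 q E hq ((hs' _ _ (fun h => hne.1 h.2)).1 hEq) with ⟨h1, h2⟩ | ⟨h1, h2, h3⟩
    · exact Or.inl ⟨h1, (hs' _ _ (fun h => hne.2 h.1)).2 h2⟩
    · refine Or.inr ⟨h1, (hs' _ _ (fun h => hBA h.2.symm)).2 h2, ?_⟩
      rwa [hsame B E (fun h => h1 h.2), hsame q E (fun h => hne.2 h.1)] at h3

theorem FlipC.iff {X X' : PMG V} {A B : V} {K : V → Prop} (hX : FlipC X A B K)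
    (hadj : ∀ a b, X.Adj a b ↔ X'.Adj a b)
    (hsame : ∀ a b, ¬ (a = B ∧ b = A) → X.mark a b = X'.mark a b)
    {Z : Finset V} {a b : V} (hab : a ≠ b) : WConn X Z a b ↔ WConn X' Z a b :=
  ⟨hX.conn (fun _ _ => (hadj _ _).1) hsame hab,
   (hX.transfer hsame).conn (fun _ _ => (hadj _ _).2) (fun a b h => (hsame a b h).symm) hab⟩

/-! ### Setting one mark -/

/-- change the mark at `A` on the edge between `B` and `A`. -/
noncomputable def setMark (G : PMG V) (B A : V) (m : Mark) (h : G.Adj B A) : PMG V where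
  mark a b := if a = B ∧ b = A then some m else G.mark a b
  symm a b := by
    have h1 := G.symm a b
    have h2 : (G.mark B A).isSome := h
    have h3 := (G.symm B A).1 h2
    by_cases e1 : a = B ∧ b = A
    · obtain ⟨rfl, rfl⟩ := e1
      simp only [and_self, if_true]
      split_ifs <;> simp [h3]
    · by_cases e2 : b = B ∧ a = A
      · obtain ⟨rfl, rfl⟩ := e2
        simp [e1, h3]
      · simp [e1, e2, h1]
  irrefl a := by
    have : ¬ (a = B ∧ a = A) := by
      rintro ⟨rfl, rfl⟩; exact h.ne rfl
    simp [this, G.irrefl]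

theorem setMark_same {G : PMG V} {B A : V} {m : Mark} {h : G.Adj B A} {a b : V}
    (hn : ¬ (a = B ∧ b = A)) : (G.setMark B A m h).mark a b = G.mark a b := by
  simp [setMark, hn]

theorem setMark_self {G : PMG V} {B A : V} {m : Mark} {h : G.Adj B A} :
    (G.setMark B A m h).mark B A = some m := by
  simp [setMark]

theorem setMark_adj {G : PMG V} {B A : V} {m : Mark} {h : G.Adj B A} (a b : V) :
    G.Adj a b ↔ (G.setMark B A m h).Adj a b := by
  by_cases hn : a = B ∧ b = A
  · obtain ⟨rfl, rfl⟩ := hn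
    simp only [h, true_iff]
    unfold Adj; rw [setMark_self]; rfl
  · unfold Adj; rw [setMark_same hn]

end PMG
namespace PMG

variable {V : Type}

theorem mag_of {M M' : PMG V} (hM : IsMAG M) (hA : Anc M')
    (hadj : ∀ a b, M.Adj a b ↔ M'.Adj a b)
    (hw : ∀ (Z : Finset V) (a b : V), a ≠ b → (WConn M Z a b ↔ WConn M' Z a b)) :
    IsMAG M' ∧ MarkovEquiv M M' := by
  have hMa := anc_iff.1 hM.1
  have hs : ∀ (Z : Finset V) (a b : V), a ≠ b → (MSep M a b Z ↔ MSep M' a b Z) := by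
    intro Z a b hab
    rw [msep_iff hMa hab, msep_iff hA hab, hw Z a b hab]
  refine ⟨⟨anc_iff.2 hA, ?_⟩, ?_⟩
  · intro a b hab hn
    obtain ⟨Z, h1, h2, h3⟩ := hM.2 a b hab (fun h => hn ((hadj a b).1 h))
    exact ⟨Z, h1, h2, (hs Z a b hab).1 h3⟩
  · intro a b Z hab _ _
    exact hs Z a b hab

theorem mixed_of_marks {M : PMG V} (h : ∀ a b, M.Adj a b →
    (M.mark a b = some Mark.arrow ∨ M.mark a b = some Mark.tail))
    (h2 : ∀ a b, M.mark a b = some Mark.tail → M.mark b a = some Mark.tail → False) :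
    IsMixed M := by
  intro a b hab
  rcases h a b hab with h1 | h1 <;> rcases h b a hab.symm with h3 | h3
  · exact Or.inr (Or.inr ⟨h1, h3⟩)
  · exact Or.inl ⟨h1, h3⟩
  · exact Or.inr (Or.inl ⟨h3, h1⟩)
  · exact absurd (h2 a b h1 h3) (by simp)

theorem IsMixed.marks {M : PMG V} (hm : IsMixed M) {a b : V} (h : M.Adj a b) :
    M.mark a b = some Mark.arrow ∨ M.mark a b = some Mark.tail := by
  rcases hm a b h with h | h | h
  · exact Or.inl h.1
  · exact Or.inr h.2
  · exact Or.inl h.1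

theorem IsMixed.not_tt {M : PMG V} (hm : IsMixed M) {a b : V}
    (h1 : M.mark a b = some Mark.tail) (h2 : M.mark b a = some Mark.tail) : False := by
  have : M.Adj a b := by unfold Adj; simp [h1]
  rcases hm a b this with h | h | h
  · have := h.1; rw [h1] at this; simp at this
  · have := h.1; rw [h2] at this; simp at this
  · have := h.1; rw [h1] at this; simp at this

theorem setMark_mixed {M : PMG V} (hm : IsMixed M) {A B : V} {m : Mark} {h : M.Adj B A}
    (hAB : M.Arr A B) (hmc : m ≠ Mark.circle) : IsMixed (M.setMark B A m h) := by
  have hne : B ≠ A := h.ne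
  apply mixed_of_marks
  · intro a b hab
    by_cases hn : a = B ∧ b = A
    · obtain ⟨rfl, rfl⟩ := hn
      rw [setMark_self]; cases m <;> simp at hmc ⊢
    · rw [setMark_same hn]
      exact hm.marks ((setMark_adj a b).2 hab)
  · intro a b h1 h2
    by_cases hn : a = B ∧ b = A
    · obtain ⟨rfl, rfl⟩ := hn
      rw [setMark_same (fun h => hne h.2)] at h2
      unfold Arr at hAB; rw [hAB] at h2; simp at h2
    · by_cases hn2 : b = B ∧ a = A
      · obtain ⟨rfl, rfl⟩ := hn2
        rw [setMark_same hn] at h1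
        unfold Arr at hAB; rw [hAB] at h1; simp at h1
      · rw [setMark_same hn] at h1
        rw [setMark_same hn2] at h2
        exact hm.not_tt h1 h2

/-- Turning `A ↔ B` into `A → B`. -/
theorem flip_tail {M : PMG V} (hM : IsMAG M) {A B : V} {K : V → Prop} (hK : FlipC M A B K)
    (hBA : M.Arr B A) (hc1 : ∀ C, M.DirEdge C A → M.DirEdge C B) :
    IsMAG (M.setMark B A Mark.tail hBA.adj) ∧ MarkovEquiv M (M.setMark B A Mark.tail hBA.adj) := by
  have hMa := anc_iff.1 hM.1
  have hAB := hK.arr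
  have hne : A ≠ B := hAB.ne
  set M' := M.setMark B A Mark.tail hBA.adj with hM'
  have hdir : ∀ u w, M'.DirEdge u w → M.DirEdge u w ∨ (u = A ∧ w = B) := by
    intro u w h
    by_cases e : u = A ∧ w = B
    · exact Or.inr e
    · left
      obtain ⟨h1, h2⟩ := h
      have e1 : ¬ (u = B ∧ w = A) := by
        rintro ⟨rfl, rfl⟩
        rw [hM', setMark_self] at h1; simp at h1
      rw [hM', setMark_same e1] at h1
      rw [hM', setMark_same (fun h => e ⟨h.2, h.1⟩)] at h2
      exact ⟨h1, h2⟩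
  have hbid : ∀ u w, M'.BidirEdge u w → M.BidirEdge u w ∧ ¬ (u = B ∧ w = A) ∧ ¬ (w = B ∧ u = A) := by
    rintro u w ⟨h1, h2⟩
    have e1 : ¬ (u = B ∧ w = A) := by
      rintro ⟨rfl, rfl⟩
      rw [hM', setMark_self] at h1; simp at h1
    have e2 : ¬ (w = B ∧ u = A) := by
      rintro ⟨rfl, rfl⟩
      rw [hM', setMark_self] at h2; simp at h2
    rw [hM', setMark_same e1] at h1
    rw [hM', setMark_same e2] at h2
    exact ⟨⟨h1, h2⟩, e1, e2⟩
  have hbi : M.BidirEdge A B := ⟨hAB, hBA⟩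
  have htg : ∀ u w, Relation.TransGen M'.DirEdge u w → Relation.TransGen M.DirEdge u w ∨
      (Relation.ReflTransGen M.DirEdge u A ∧ Relation.ReflTransGen M.DirEdge B w) := by
    intro u w h
    induction h with
    | single h =>
      rcases hdir _ _ h with h | ⟨rfl, rfl⟩
      · exact Or.inl (Relation.TransGen.single h)
      · exact Or.inr ⟨Relation.ReflTransGen.refl, Relation.ReflTransGen.refl⟩
    | tail _ h ih =>
      rcases hdir _ _ h with h | ⟨rfl, rfl⟩
      · rcases ih with ih | ih
        · exact Or.inl (ih.tail h)
        · exact Or.inr ⟨ih.1, ih.2.tail h⟩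
      · rcases ih with ih | ih
        · exact Or.inr ⟨ih.to_reflTransGen, Relation.ReflTransGen.refl⟩
        · exact Or.inr ⟨ih.1, Relation.ReflTransGen.refl⟩
  have hBAno : ¬ Relation.ReflTransGen M.DirEdge B A := by
    intro h
    rcases Relation.reflTransGen_iff_eq_or_transGen.1 h with h | h
    · exact hne h
    · exact hMa.almost B A h hbi
  have hA' : Anc M' := by
    refine ⟨setMark_mixed hMa.mixed hAB (by simp), ?_, ?_⟩
    · intro a h
      rcases htg a a h with h | ⟨h1, h2⟩
      · exact hMa.acyc a h
      · exact hBAno (h2.trans h1)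
    · intro a b h hb
      obtain ⟨hb, e1, e2⟩ := hbid _ _ hb
      rcases htg a b h with h | ⟨h1, h2⟩
      · exact hMa.almost a b h hb
      · rcases Relation.ReflTransGen.cases_tail h1 with h3 | ⟨C, h3, h4⟩
        · subst h3
          have hbB : b ≠ B := fun h => e1 ⟨h, rfl⟩
          have hk := (hK.k1 b hbB hb.1).1
          have htr : Relation.TransGen M.DirEdge B b := by
            rcases Relation.reflTransGen_iff_eq_or_transGen.1 h2 with h | h
            · exact absurd h hbB
            · exact h
          rcases hMa.mixed b B hk.adj with h | h | h
          · exact hMa.acyc B (htr.tail h)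
          · exact h.not_arr hk
          · exact hMa.almost B b htr h
        · have h5 := hc1 C h4
          have : Relation.TransGen M.DirEdge a b :=
            (Relation.TransGen.tail' h3 h5).trans_left h2
          exact hMa.almost a b this hb
  refine mag_of hM hA' (fun a b => setMark_adj a b) ?_
  intro Z a b hab
  exact hK.iff (fun a b => setMark_adj a b) (fun a b h => (setMark_same h).symm) hab

/-- Turning `A → B` into `A ↔ B`. -/
theorem flip_arrow {M : PMG V} (hM : IsMAG M) {A B : V} {K : V → Prop} (hK : FlipC M A B K)
    (hdAB : M.DirEdge A B) (hc1 : ∀ C, C ≠ A → M.DirEdge C B → M.DirEdge C A) :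
    IsMAG (M.setMark B A Mark.arrow hdAB.adj.symm) ∧
      MarkovEquiv M (M.setMark B A Mark.arrow hdAB.adj.symm) := by
  have hMa := anc_iff.1 hM.1
  have hAB := hK.arr
  have hne : A ≠ B := hAB.ne
  set M' := M.setMark B A Mark.arrow hdAB.adj.symm with hM'
  have hdir : ∀ u w, M'.DirEdge u w → M.DirEdge u w ∧ ¬ (u = A ∧ w = B) := by
    rintro u w ⟨h1, h2⟩
    have e2 : ¬ (w = B ∧ u = A) := by
      rintro ⟨rfl, rfl⟩
      rw [hM', setMark_self] at h2; simp at h2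
    rw [hM', setMark_same e2] at h2
    have e1 : ¬ (u = B ∧ w = A) := by
      rintro ⟨rfl, rfl⟩
      unfold Arr at hAB; rw [hAB] at h2; simp at h2
    rw [hM', setMark_same e1] at h1
    exact ⟨⟨h1, h2⟩, fun h => e2 ⟨h.2, h.1⟩⟩
  have htg : ∀ u w, Relation.TransGen M'.DirEdge u w → Relation.TransGen M.DirEdge u w :=
    fun u w h => Relation.TransGen.mono (fun a b h => (hdir a b h).1) _ _ h
  have hA' : Anc M' := by
    refine ⟨setMark_mixed hMa.mixed hAB (by simp), ?_, ?_⟩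
    · intro a h
      exact hMa.acyc a (htg a a h)
    · rintro a b h ⟨hb1, hb2⟩
      by_cases e1 : b = B ∧ a = A
      · obtain ⟨rfl, rfl⟩ := e1
        obtain ⟨C, h1, h2⟩ := Relation.TransGen.tail'_iff.1 h
        obtain ⟨h3, h4⟩ := hdir _ _ h2
        have hCA : C ≠ a := fun h => h4 ⟨h, rfl⟩
        have h5 := hc1 C hCA h3
        have h6 : Relation.ReflTransGen M.DirEdge a C :=
          Relation.ReflTransGen.mono (fun a b h => (hdir a b h).1) _ _ h1
        exact hMa.acyc a (Relation.TransGen.tail' h6 h5)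
      · by_cases e2 : a = B ∧ b = A
        · obtain ⟨rfl, rfl⟩ := e2
          exact hMa.acyc _ ((htg _ _ h).tail hdAB)
        · rw [hM', setMark_same e1] at hb1
          rw [hM', setMark_same e2] at hb2
          exact hMa.almost a b (htg _ _ h) ⟨hb1, hb2⟩
  refine mag_of hM hA' (fun a b => setMark_adj a b) ?_
  intro Z a b hab
  exact hK.iff (fun a b => setMark_adj a b) (fun a b h => (setMark_same h).symm) hab

end PMG
namespace PMG

variable {V : Type}

/-! ### The arrowheads forced by a closure -/

/-- A Markov equivalence class of MAGs with its adjacencies and separations. -/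
structure Ctx (cls : Set (PMG V)) (ad : V → V → Prop) (S : V → V → Finset V → Prop) : Prop where
  ne : cls.Nonempty
  mag : ∀ M ∈ cls, IsMAG M
  closed : ∀ M ∈ cls, ∀ M', IsMAG M' → MarkovEquiv M M' → M' ∈ cls
  adj : ∀ M ∈ cls, ∀ a b, M.Adj a b ↔ ad a b
  sep : ∀ M ∈ cls, ∀ D E Z, S D E Z ↔ (D ≠ E ∧ D ∉ Z ∧ E ∉ Z ∧ ¬ WConn M Z D E)

theorem Ctx.anc {cls : Set (PMG V)} {ad : V → V → Prop} {S : V → V → Finset V → Prop}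
    (c : Ctx cls ad S) {M : PMG V} (hM : M ∈ cls) : Anc M := anc_iff.1 (c.mag M hM).1

theorem Ctx.ad_symm {cls : Set (PMG V)} {ad : V → V → Prop} {S : V → V → Finset V → Prop}
    (c : Ctx cls ad S) {a b : V} (h : ad a b) : ad b a := by
  obtain ⟨M, hM⟩ := c.ne
  rw [← c.adj M hM] at h ⊢; exact h.symm

theorem Ctx.ad_ne {cls : Set (PMG V)} {ad : V → V → Prop} {S : V → V → Finset V → Prop}
    (c : Ctx cls ad S) {a b : V} (h : ad a b) : a ≠ b := by
  obtain ⟨M, hM⟩ := c.ne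
  rw [← c.adj M hM] at h; exact h.ne

theorem Ctx.S_symm {cls : Set (PMG V)} {ad : V → V → Prop} {S : V → V → Finset V → Prop}
    (c : Ctx cls ad S) {a b : V} {Z : Finset V} (h : S a b Z) : S b a Z := by
  obtain ⟨M, hM⟩ := c.ne
  rw [c.sep M hM] at h ⊢
  exact ⟨h.1.symm, h.2.2.1, h.2.1, fun hw => h.2.2.2 hw.symm⟩

theorem Ctx.S_ex {cls : Set (PMG V)} {ad : V → V → Prop} {S : V → V → Finset V → Prop}
    (c : Ctx cls ad S) {a b : V} (h : a ≠ b) (hn : ¬ ad a b) : ∃ Z, S a b Z := by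
  obtain ⟨M, hM⟩ := c.ne
  rw [← c.adj M hM] at hn
  obtain ⟨Z, h1, h2, h3⟩ := (c.mag M hM).2 a b h hn
  exact ⟨Z, (c.sep M hM a b Z).2 ⟨h, h1, h2, (msep_iff (c.anc hM) h).1 h3⟩⟩

/-- `J a b`: a forced arrowhead at `b` on the edge between `a` and `b`. -/
inductive J (ad : V → V → Prop) (S : V → V → Finset V → Prop) : V → V → Prop
  | rs {D E B C : V} {Z : Finset V} (hDE : D ≠ E) (hn : ¬ ad D E) (hZ : S D E Z)
      (hC : C ∈ Z ∨ C = D ∨ C = E) (h1 : B ≠ D) (h2 : B ≠ E)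
      (hex : ∀ Z', S D E Z' → B ∉ Z') (hCB : ad C B) : J ad S C B
  | r1 {E A B : V} {Z : Finset V} (h : J ad S E A) (hne : E ≠ B) (hn : ¬ ad E B) (hAB : ad A B)
      (hZ : S E B Z) (hA : A ∈ Z) : J ad S A B
  | r2a {A E B F : V} {Z : Finset V} (hF : J ad S F A) (hne : F ≠ E) (hn : ¬ ad F E)
      (hAE : ad A E) (hZ : S F E Z) (hA : A ∈ Z) (h1 : J ad S A E) (h2 : J ad S E B)
      (hAB : ad A B) : J ad S A B
  | r2b {A E B F : V} {Z : Finset V} (h1 : J ad S A E) (hF : J ad S F E) (hne : F ≠ B)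
      (hn : ¬ ad F B) (hEB : ad E B) (hZ : S F B Z) (hE : E ∈ Z) (h2 : J ad S E B)
      (hAB : ad A B) : J ad S A B

/-- forced tail at `A` on the edge between `A` and `B`. -/
def T (ad : V → V → Prop) (S : V → V → Finset V → Prop) (A B : V) : Prop :=
  ∃ F Z, J ad S F A ∧ F ≠ B ∧ ¬ ad F B ∧ ad A B ∧ S F B Z ∧ A ∈ Z

variable {cls : Set (PMG V)} {ad : V → V → Prop} {S : V → V → Finset V → Prop}

theorem J.adj {a b : V} (h : J ad S a b) : ad a b := by
  cases h <;> assumption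

theorem T.J {a b : V} (h : T ad S a b) : J ad S a b := by
  obtain ⟨F, Z, h1, h2, h3, h4, h5, h6⟩ := h
  exact PMG.J.r1 h1 h2 h3 h4 h5 h6

theorem T.r2a {A E B : V} (h : T ad S A E) (h2 : PMG.J ad S E B) (hAB : ad A B) :
    PMG.J ad S A B := by
  obtain ⟨F, Z, g1, g2, g3, g4, g5, g6⟩ := id h
  exact PMG.J.r2a g1 g2 g3 g4 g5 g6 h.J h2 hAB

theorem T.r2b {A E B : V} (h : T ad S E B) (h2 : PMG.J ad S A E) (hAB : ad A B) :
    PMG.J ad S A B := by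
  obtain ⟨F, Z, g1, g2, g3, g4, g5, g6⟩ := id h
  exact PMG.J.r2b h2 g1 g2 g3 g4 g5 g6 h.J hAB

theorem Ctx.lemL (c : Ctx cls ad S) {E A B : V} (h : J ad S E A) (hne : E ≠ B) (hn : ¬ ad E B)
    (hAB : ad A B) : J ad S B A ∨ T ad S A B := by
  by_cases hex : ∃ Z, S E B Z ∧ A ∈ Z
  · obtain ⟨Z, h1, h2⟩ := hex
    exact Or.inr ⟨E, Z, h, hne, hn, hAB, h1, h2⟩
  · left
    obtain ⟨Z, hZ⟩ := c.S_ex hne hn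
    exact J.rs hne hn hZ (Or.inr (Or.inr rfl)) (c.ad_ne h.adj).symm (c.ad_ne hAB)
      (fun Z' h1 h2 => hex ⟨Z', h1, h2⟩) (c.ad_symm hAB)

theorem Ctx.cp1 (c : Ctx cls ad S) {A B C : V} (h : J ad S A B) (hCB : ad C B)
    (hJ : ¬ J ad S C B) (hT : ¬ T ad S B C) (hCA : C ≠ A) : J ad S A C := by
  induction h with
  | @rs D E B C' Z hDE hn hZ hC h1 h2 hex hCB' =>
    have hac : ad C' C := by
      by_contra hac
      rcases c.lemL (J.rs hDE hn hZ hC h1 h2 hex hCB') hCA.symm hac (c.ad_symm hCB) with h | h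
      · exact hJ h
      · exact hT h
    refine J.rs hDE hn hZ hC ?_ ?_ ?_ hac
    · rintro rfl; exact hJ (J.rs hDE hn hZ (Or.inr (Or.inl rfl)) h1 h2 hex hCB)
    · rintro rfl; exact hJ (J.rs hDE hn hZ (Or.inr (Or.inr rfl)) h1 h2 hex hCB)
    · intro Z' hZ' hC'
      exact hJ (J.rs hDE hn hZ' (Or.inl hC') h1 h2 hex hCB)
  | @r1 E A B Z h hne hn hAB hZ hA ih =>
    have hTAB : T ad S A B := ⟨E, Z, h, hne, hn, hAB, hZ, hA⟩
    have hac : ad A C := by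
      by_contra hac
      rcases c.lemL hTAB.J hCA.symm hac (c.ad_symm hCB) with h | h
      · exact hJ h
      · exact hT h
    have hCE : C ≠ E := by rintro rfl; exact hn hCB
    by_cases hca : J ad S C A
    · exact absurd (hTAB.r2b hca hCB) hJ
    by_cases htc : T ad S A C
    · exact htc.J
    by_cases hEC : ad E C
    · by_cases hex : ∃ Z', S E B Z' ∧ C ∈ Z'
      · obtain ⟨Z', h1, h2⟩ := hex
        have := ih (c.ad_symm hac) hca htc hCE
        exact absurd (J.r1 this hne hn hCB h1 h2) hJ
      · have hBC : J ad S B C := J.rs hne hn hZ (Or.inr (Or.inr rfl)) hCE (c.ad_ne hCB)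
          (fun Z' h1 h2 => hex ⟨Z', h1, h2⟩) (c.ad_symm hCB)
        exact hTAB.r2a hBC hac
    · rcases c.lemL h hCE.symm hEC hac with h1 | h1
      · exact absurd h1 hca
      · exact absurd h1 htc
  | @r2a A E B F Z hF hne hn hAE hZ hA h1 h2 hAB ih0 ih1 ih2 =>
    have hTAE : T ad S A E := ⟨F, Z, hF, hne, hn, hAE, hZ, hA⟩
    have hac : ad A C := by
      by_contra hac
      rcases c.lemL (hTAE.r2a h2 hAB) hCA.symm hac (c.ad_symm hCB) with h | h
      · exact hJ h
      · exact hT h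
    have hCE : C ≠ E := by rintro rfl; exact hJ h2
    exact hTAE.r2a (ih2 hCB hJ hT hCE) hac
  | @r2b A E B F Z h1 hF hne hn hEB hZ hE h2 hAB ih1 ih0 ih2 =>
    have hTEB : T ad S E B := ⟨F, Z, hF, hne, hn, hEB, hZ, hE⟩
    have hac : ad A C := by
      by_contra hac
      rcases c.lemL (hTEB.r2b h1 hAB) hCA.symm hac (c.ad_symm hCB) with h | h
      · exact hJ h
      · exact hT h
    have hCE : C ≠ E := by rintro rfl; exact hJ h2
    have hEC := ih2 hCB hJ hT hCE
    by_cases h3 : J ad S C E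
    · exact absurd (hTEB.r2b h3 hCB) hJ
    by_cases h4 : T ad S E C
    · exact h4.r2b h1 hac
    exact ih1 (c.ad_symm hEC.adj) h3 h4 hCA

theorem Ctx.cp (c : Ctx cls ad S) {A B C : V} (h : J ad S A B) (hAC : ad A C) (hBC : ad B C)
    (hJ : ¬ J ad S C B) : J ad S A C := by
  by_cases hT : T ad S B C
  · exact hT.r2b h hAC
  · exact c.cp1 h (c.ad_symm hBC) hJ hT (c.ad_ne hAC).symm

theorem Ctx.S_add (c : Ctx cls ad S) {M : PMG V} (hM : M ∈ cls) {B C D E : V} {Z : Finset V}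
    (hZ : S D E Z) (hBC : M.DirEdge B C) (hC : C ∈ Z ∨ C = D ∨ C = E) (h1 : B ≠ D) (h2 : B ≠ E) :
    S D E (insert B Z) := by
  rw [c.sep M hM] at hZ ⊢
  refine ⟨hZ.1, ?_, ?_, add_lemma hZ.2.2.2 hBC hC⟩
  · simp [h1.symm, hZ.2.1]
  · simp [h2.symm, hZ.2.2.1]

theorem Ctx.S_excl (c : Ctx cls ad S) {M : PMG V} (hM : M ∈ cls) {B D E : V} {Z : Finset V}
    (h1 : M.Arr D B) (h2 : M.Arr E B) (hZ : S D E Z) : B ∉ Z := by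
  intro hB
  exact ((c.sep M hM D E Z).1 hZ).2.2.2 (excl_lemma h1 h2 hB)

theorem Ctx.sound (c : Ctx cls ad S) {a b : V} (h : J ad S a b) {M : PMG V} (hM : M ∈ cls) :
    M.Arr a b := by
  have hA := c.anc hM
  have tail : ∀ {E A B : V} {Z : Finset V}, M.Arr E A → S E B Z → A ∈ Z → ¬ M.Arr B A :=
    fun h1 h2 h3 h4 => c.S_excl hM h1 h4 h2 h3
  have dir : ∀ {E A B : V} {Z : Finset V}, M.Arr E A → S E B Z → A ∈ Z → ad A B → M.DirEdge A B :=
    fun h1 h2 h3 h4 => hA.mixed.dir_of_not_arr ((c.adj M hM _ _).2 h4) (tail h1 h2 h3)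
  induction h with
  | @rs D E B C Z hDE hn hZ hC h1 h2 hex hCB =>
    by_contra hcon
    have hBC := hA.mixed.dir_of_not_arr ((c.adj M hM _ _).2 hCB).symm hcon
    exact hex _ (c.S_add hM hZ hBC hC h1 h2) (by simp)
  | @r1 E A B Z h hne hn hAB hZ hA ih => exact (dir ih hZ hA hAB).arr
  | @r2a A E B F Z hF hne hn hAE hZ hA' h1 h2 hAB ih0 ih1 ih2 =>
    exact hA.r2a (dir ih0 hZ hA' hAE) ih2 ((c.adj M hM _ _).2 hAB)
  | @r2b A E B F Z h1 hF hne hn hEB hZ hE h2 hAB ih1 ih0 ih2 =>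
    exact hA.r2b ih1 (dir ih0 hZ hE hEB) ((c.adj M hM _ _).2 hAB)

theorem Ctx.soundT (c : Ctx cls ad S) {a b : V} (h : T ad S a b) {M : PMG V} (hM : M ∈ cls) :
    M.DirEdge a b := by
  obtain ⟨F, Z, h1, h2, h3, h4, h5, h6⟩ := h
  refine (c.anc hM).mixed.dir_of_not_arr ((c.adj M hM _ _).2 h4) ?_
  intro h7
  exact c.S_excl hM (c.sound h1 hM) h7 h5 h6

/-- unshielded colliders are forced. -/
theorem Ctx.J_coll (c : Ctx cls ad S) {M : PMG V} (hM : M ∈ cls) {a b d : V}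
    (h1 : M.Arr a b) (h2 : M.Arr d b) (hne : a ≠ d) (hn : ¬ ad a d) : J ad S a b := by
  obtain ⟨Z, hZ⟩ := c.S_ex hne hn
  exact J.rs hne hn hZ (Or.inr (Or.inl rfl)) h1.ne.symm h2.ne.symm
    (fun Z' h => c.S_excl hM h1 h2 h) ((c.adj M hM _ _).1 h1.adj)

theorem IsPAGOf.ctx {P : PMG V} (h : IsPAGOf P cls) : ∃ S, Ctx cls P.Adj S := by
  obtain ⟨⟨M0, h0⟩, h1, h2, h3, h4, h5, h6⟩ := h
  refine ⟨fun D E Z => D ≠ E ∧ D ∉ Z ∧ E ∉ Z ∧ ¬ WConn M0 Z D E, ⟨M0, h0⟩, h1, h2,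
    fun M hM a b => (h4 M hM a b).symm, ?_⟩
  intro M hM D E Z
  constructor
  · rintro ⟨g1, g2, g3, g4⟩
    refine ⟨g1, g2, g3, ?_⟩
    rw [← msep_iff (anc_iff.1 (h1 _ hM).1) g1, ← h3 M0 h0 M hM D E Z g1 g2 g3,
      msep_iff (anc_iff.1 (h1 _ h0).1) g1]
    exact g4
  · rintro ⟨g1, g2, g3, g4⟩
    refine ⟨g1, g2, g3, ?_⟩
    rw [← msep_iff (anc_iff.1 (h1 _ h0).1) g1, h3 M0 h0 M hM D E Z g1 g2 g3,
      msep_iff (anc_iff.1 (h1 _ hM).1) g1]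
    exact g4

end PMG
namespace PMG

variable {V : Type}
variable {cls : Set (PMG V)} {ad : V → V → Prop} {S : V → V → Finset V → Prop}

/-! ### MAGs in which all bidirected edges are forced -/

/-- the auxiliary chain of nodes. -/
inductive KC (M : PMG V) (A B : V) : V → Prop
  | base {q : V} (h1 : M.DirEdge q B) (h2 : M.BidirEdge q A) : KC M A B q
  | step {q q' : V} (h1 : M.DirEdge q B) (h2 : M.BidirEdge q q') (h : KC M A B q') : KC M A B q

theorem KC.dir {M : PMG V} {A B q : V} (h : KC M A B q) : M.DirEdge q B := by
  cases h <;> assumption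

theorem KC.walk {M : PMG V} {A B q : V} (h : KC M A B q) (hAB : M.BidirEdge A B) {Z : Finset V}
    (hA : A ∈ Z) : ∀ {E : V}, M.Arr E q → ∃ n w, DW M Z n E q w B := by
  induction h with
  | @base q h1 h2 =>
    intro E hE
    by_cases hq : q ∈ Z
    · have t1 : Tri M Z E q A := ⟨hE.adj, Arr.adj (G := M) h2.1, by
        have : M.Arr A q := h2.2
        simp [hq, hE, this]⟩
      have t2 : Tri M Z q A B := ⟨Arr.adj (G := M) h2.1, Arr.adj (G := M) hAB.1, by
        have e1 : M.Arr q A := h2.1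
        have e2 : M.Arr B A := hAB.2
        simp [hA, e1, e2]⟩
      exact ⟨_, _, t1.dw.snoc t2⟩
    · have t1 : Tri M Z E q B := ⟨hE.adj, h1.adj, by simp [hq, h1.not_arr]⟩
      exact ⟨_, _, t1.dw⟩
  | @step q q' h1 h2 h ih =>
    intro E hE
    by_cases hq : q ∈ Z
    · have t1 : Tri M Z E q q' := ⟨hE.adj, Arr.adj (G := M) h2.1, by
        have : M.Arr q' q := h2.2
        simp [hq, hE, this]⟩
      obtain ⟨n, w, h⟩ := ih (E := q) h2.1
      exact ⟨_, _, t1.dw.append h⟩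
    · have t1 : Tri M Z E q B := ⟨hE.adj, h1.adj, by simp [hq, h1.not_arr]⟩
      exact ⟨_, _, t1.dw⟩

/-- all bidirected edges are forced. -/
def S1 (ad : V → V → Prop) (S : V → V → Finset V → Prop) (M : PMG V) : Prop :=
  ∀ a b, M.BidirEdge a b → J ad S b a

/-- number of arrowheads. -/
noncomputable def nArr [Fintype V] (M : PMG V) : ℕ :=
  (Finset.univ.filter (fun p : V × V => M.Arr p.1 p.2)).card

theorem Anc.wf [Finite V] {M : PMG V} (h : Anc M) : WellFounded (Relation.TransGen M.DirEdge) := by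
  have : Std.Irrefl (Relation.TransGen M.DirEdge) := ⟨h.acyc⟩
  have : IsTrans V (Relation.TransGen M.DirEdge) := ⟨fun _ _ _ => Relation.TransGen.trans⟩
  exact Finite.wellFounded_of_trans_of_irrefl _

theorem Anc.wf' [Finite V] {M : PMG V} (h : Anc M) :
    WellFounded (Function.swap (Relation.TransGen M.DirEdge)) := by
  have : Std.Irrefl (Function.swap (Relation.TransGen M.DirEdge)) := ⟨h.acyc⟩
  have : IsTrans V (Function.swap (Relation.TransGen M.DirEdge)) :=
    ⟨fun _ _ _ h1 h2 => Relation.TransGen.trans h2 h1⟩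
  exact Finite.wellFounded_of_trans_of_irrefl _

theorem Ctx.exists_S1 [Fintype V] (c : Ctx cls ad S) : ∃ M ∈ cls, S1 ad S M := by
  have hex : ∃ n, ∃ M ∈ cls, nArr M = n := by
    obtain ⟨M, hM⟩ := c.ne; exact ⟨_, M, hM, rfl⟩
  obtain ⟨M, hM, hn⟩ := Nat.find_spec hex
  have hmin : ∀ M' ∈ cls, nArr M ≤ nArr M' := by
    intro M' hM'
    rw [hn]; exact Nat.find_min' hex ⟨M', hM', rfl⟩
  refine ⟨M, hM, ?_⟩
  by_contra hcon
  have hA := c.anc hM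
  have had := c.adj M hM
  have hU : ∃ B, ∃ A, M.BidirEdge A B ∧ ¬ J ad S B A := by
    unfold S1 at hcon; push Not at hcon
    obtain ⟨a, b, h1, h2⟩ := hcon
    exact ⟨b, a, h1, h2⟩
  obtain ⟨B, hB, hBmax⟩ := hA.wf'.has_min {B | ∃ A, M.BidirEdge A B ∧ ¬ J ad S B A} hU
  obtain ⟨A, ⟨hbi, hJ⟩, hAmin⟩ := hA.wf.has_min {A | M.BidirEdge A B ∧ ¬ J ad S B A} hB
  have hAB : M.Arr A B := hbi.1
  have hBA : M.Arr B A := hbi.2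
  have hadBA : ad B A := (had _ _).1 hBA.adj
  have hadAB : ad A B := (had _ _).1 hAB.adj
  -- basic facts about nodes with an arrow into `A`
  have hb1 : ∀ E, E ≠ B → M.Arr E A → M.Arr E B := by
    intro E hEB hEA
    have hadE : ad E B := by
      by_contra hcon
      exact hJ (c.J_coll hM hBA hEA hEB.symm (fun h => hcon (c.ad_symm h)))
    by_contra hcon
    have hBE := hA.mixed.dir_of_not_arr ((had _ _).2 hadE).symm hcon
    by_cases hAE : M.Arr A E
    · refine hBmax E ⟨A, ⟨hAE, hEA⟩, ?_⟩ (Relation.TransGen.single hBE)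
      intro hJ2
      have := c.cp hJ2 hadE hadAB hJ
      exact hcon (c.sound this hM)
    · have hdE := hA.mixed.dir_of_not_arr hEA.adj hAE
      exact hA.almost B A ((Relation.TransGen.single hBE).tail hdE) hbi
  have hb2 : ∀ E, M.DirEdge E A → M.DirEdge E B := by
    intro E hEA
    have hEB : E ≠ B := by rintro rfl; exact hEA.not_arr hAB
    have h1 := hb1 E hEB hEA.arr
    by_contra hcon
    have hBE : M.Arr B E := by
      by_contra h; exact hcon (hA.mixed.dir_of_not_arr h1.adj h)
    refine hAmin E ⟨⟨h1, hBE⟩, ?_⟩ (Relation.TransGen.single hEA)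
    intro hJ2
    exact hJ (c.cp hJ2 hadBA ((had _ _).1 hEA.adj) (fun h => hEA.not_arr (c.sound h hM)))
  have hflip : FlipC M A B (KC M A B) := by
    refine ⟨hAB, ?_, ?_, ?_⟩
    · intro q hq
      refine ⟨?_, hq.dir.ne⟩
      rintro rfl; exact hq.dir.not_arr hBA
    · intro E hEB hEA
      have h1 := hb1 E hEB hEA
      refine ⟨h1, ?_⟩
      by_cases hAE : M.Arr A E
      · by_cases hBE : M.Arr B E
        · left; unfold Arr at hAE hBE; rw [hAE, hBE]
        · right; exact KC.base (hA.mixed.dir_of_not_arr h1.adj hBE) ⟨hEA, hAE⟩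
      · left
        have h2 := hA.mixed.dir_of_not_arr hEA.adj hAE
        rw [h2.2, (hb2 E h2).2]
    · intro q E hq hEq
      by_cases hEA : E = A
      · subst hEA
        refine Or.inl ⟨rfl, ?_⟩
        by_contra hcon
        have h1 := hA.mixed.dir_of_not_arr hEq.adj hcon
        exact hA.almost E B ((Relation.TransGen.single h1).tail hq.dir) ⟨hBA, hAB⟩
      · refine Or.inr ⟨hEA, ?_⟩
        have hEB : E ≠ B := by rintro rfl; exact hq.dir.not_arr hEq
        have hadE : ad E B := by
          by_contra hcon
          obtain ⟨Z, hZ⟩ := c.S_ex hEB hcon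
          refine hJ (J.rs hEB hcon hZ (Or.inr (Or.inr rfl)) (Ne.symm hEA) hAB.ne ?_ hadBA)
          intro Z' hZ' hAZ'
          obtain ⟨n, w, h⟩ := hq.walk hbi hAZ' hEq
          exact ((c.sep M hM _ _ _).1 hZ').2.2.2 ⟨_, _, _, h⟩
        have h1 := hA.r2b hEq hq.dir ((had _ _).2 hadE)
        refine ⟨h1, ?_⟩
        by_cases hqE : M.Arr q E
        · by_cases hBE : M.Arr B E
          · left; unfold Arr at hqE hBE; rw [hqE, hBE]
          · right; exact KC.step (hA.mixed.dir_of_not_arr h1.adj hBE) ⟨hEq, hqE⟩ hq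
        · left
          have h2 := hA.mixed.dir_of_not_arr hEq.adj hqE
          rw [h2.2, (hA.r2c h2 hq.dir h1.adj).2]
  obtain ⟨g1, g2⟩ := flip_tail (c.mag M hM) hflip hBA hb2
  have hM' := c.closed M hM _ g1 g2
  have hlt : nArr (M.setMark B A Mark.tail hBA.adj) < nArr M := by
    unfold nArr
    apply Finset.card_lt_card
    rw [Finset.ssubset_iff_of_subset]
    · refine ⟨(B, A), by simpa using hBA, ?_⟩
      simp only [Finset.mem_filter, Finset.mem_univ, true_and]
      unfold Arr; rw [setMark_self]; simp
    · rintro ⟨u, w⟩ h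
      simp only [Finset.mem_filter, Finset.mem_univ, true_and] at h ⊢
      unfold Arr at h ⊢
      by_cases e : u = B ∧ w = A
      · obtain ⟨rfl, rfl⟩ := e; exact hBA
      · rwa [setMark_same e] at h
  exact absurd (hmin _ hM') (by omega)

end PMG
namespace PMG

variable {V : Type}
variable {cls : Set (PMG V)} {ad : V → V → Prop} {S : V → V → Finset V → Prop}

/-! ### Reorienting so that a given node has only forced arrowheads -/

/-- unforced directed edge. -/
def HE (ad : V → V → Prop) (S : V → V → Finset V → Prop) (M : PMG V) (a b : V) : Prop :=
  M.DirEdge a b ∧ ¬ J ad S a b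

/-- agreement of marks except within `C`. -/
def Agr (M M' : PMG V) (C : Set V) : Prop :=
  ∀ a b, ¬ (a ∈ C ∧ b ∈ C) → M'.mark a b = M.mark a b

theorem Agr.he {M M' : PMG V} {C : Set V} (h : Agr M M' C) {a b : V} (hab : ¬ (a ∈ C ∧ b ∈ C)) :
    HE ad S M' a b ↔ HE ad S M a b := by
  unfold HE DirEdge
  rw [h a b hab, h b a (fun h => hab ⟨h.2, h.1⟩)]

theorem Agr.trans {M M' M'' : PMG V} {C : Set V} (h : Agr M M' C) (h2 : Agr M' M'' C) :
    Agr M M'' C := fun a b hab => (h2 a b hab).trans (h a b hab)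

theorem Agr.mono {M M' : PMG V} {C D : Set V} (h : Agr M M' C) (hCD : C ⊆ D) :
    Agr M M' D := fun a b hab => h a b (fun h => hab ⟨hCD h.1, hCD h.2⟩)

theorem Ctx.twin (c : Ctx cls ad S) {M : PMG V} (hM : M ∈ cls) (h1 : S1 ad S M) {A B : V}
    (hAB : HE ad S M A B) (hc1 : ∀ C, HE ad S M C A → HE ad S M C B)
    (hc2 : ∀ C, C ≠ A → HE ad S M C B → HE ad S M C A) {C : V} (hCA : C ≠ A) (hCB : C ≠ B) :
    (M.Arr C A ↔ M.Arr C B) ∧ (M.Arr C A → M.mark B C = M.mark A C) := by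
  have hA := c.anc hM
  have had := c.adj M hM
  have hadAB : ad A B := (had _ _).1 hAB.1.adj
  have hadBA : ad B A := c.ad_symm hadAB
  have hBAn : ¬ J ad S B A := fun h => hAB.1.not_arr (c.sound h hM)
  have hABn : ¬ J ad S A B := hAB.2
  have d1 : M.Arr C A → M.Arr C B := by
    intro h
    by_cases hJ : J ad S C A
    · have hadC : ad C B := by
        by_contra hcon
        rcases c.lemL hJ hCB hcon hadAB with g | g
        · exact hBAn g
        · exact hABn g.J
      exact c.sound (c.cp hJ hadC hadAB hBAn) hM
    · have hdir : M.DirEdge C A := by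
        refine hA.mixed.dir_of_not_arr h.adj ?_
        intro g; exact hJ (h1 A C ⟨g, h⟩)
      exact (hc1 C ⟨hdir, hJ⟩).1.arr
  have d2 : M.Arr C B → M.Arr C A := by
    intro h
    by_cases hJ : J ad S C B
    · have hadC : ad C A := by
        by_contra hcon
        rcases c.lemL hJ hCA hcon hadBA with g | g
        · exact hABn g
        · exact hBAn g.J
      exact c.sound (c.cp hJ hadC hadBA hABn) hM
    · have hdir : M.DirEdge C B := by
        refine hA.mixed.dir_of_not_arr h.adj ?_
        intro g; exact hJ (h1 B C ⟨g, h⟩)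
      exact (hc2 C hCA ⟨hdir, hJ⟩).1.arr
  refine ⟨⟨d1, d2⟩, ?_⟩
  intro hCA1
  have hCB1 := d1 hCA1
  have hadCA : ad C A := (had _ _).1 hCA1.adj
  have hadCB : ad C B := (had _ _).1 hCB1.adj
  by_cases hAC : M.Arr A C
  · have hJ : J ad S A C := h1 C A ⟨hCA1, hAC⟩
    have hBC : M.Arr B C := by
      by_contra hcon
      exact hABn (c.cp hJ hadAB hadCB (fun g => hcon (c.sound g hM)))
    unfold Arr at hAC hBC; rw [hAC, hBC]
  · have hBC : ¬ M.Arr B C := by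
      intro hBC
      have hJ : J ad S B C := h1 C B ⟨hCB1, hBC⟩
      exact hBAn (c.cp hJ hadBA hadCA (fun g => hAC (c.sound g hM)))
    rw [(hA.mixed.dir_of_not_arr hCA1.adj hAC).2, (hA.mixed.dir_of_not_arr hCB1.adj hBC).2]

theorem Ctx.reverse (c : Ctx cls ad S) {M : PMG V} (hM : M ∈ cls) (h1 : S1 ad S M) {A B : V}
    (hAB : HE ad S M A B) (hc1 : ∀ C, HE ad S M C A → HE ad S M C B)
    (hc2 : ∀ C, C ≠ A → HE ad S M C B → HE ad S M C A) :
    ∃ M' ∈ cls, S1 ad S M' ∧ M'.DirEdge B A ∧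
      ∀ a b, ¬ (a = A ∧ b = B) → ¬ (a = B ∧ b = A) → M'.mark a b = M.mark a b := by
  have hne : A ≠ B := hAB.1.ne
  have tw := fun {C : V} => c.twin hM h1 hAB hc1 hc2 (C := C)
  have hBAm : M.mark B A = some Mark.tail := hAB.1.2
  have f1 : FlipC M A B (fun _ => False) := by
    refine ⟨hAB.1.arr, fun _ h => h.elim, ?_, fun _ _ h => h.elim⟩
    intro E hEB hEA
    have := tw hEA.ne hEB
    exact ⟨this.1.1 hEA, Or.inl (this.2 hEA)⟩
  have g1 : ∀ C, C ≠ A → M.DirEdge C B → M.DirEdge C A := by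
    intro C hCA hCB
    have := tw hCA hCB.ne
    have h2 := this.1.2 hCB.arr
    exact ⟨h2, by rw [← this.2 h2]; exact hCB.2⟩
  obtain ⟨m1, e1⟩ := flip_arrow (c.mag M hM) f1 hAB.1 g1
  set M1 := M.setMark B A Mark.arrow hAB.1.adj.symm with hM1
  have hM1c := c.closed M hM _ m1 e1
  have s1 : ∀ a b, ¬ (a = B ∧ b = A) → M1.mark a b = M.mark a b := fun a b h => setMark_same h
  have sB : M1.Arr B A := setMark_self
  have sA : M1.Arr A B := by
    unfold Arr; rw [s1 _ _ (fun h => hne h.1)]; exact hAB.1.1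
  have f2 : FlipC M1 B A (fun _ => False) := by
    refine ⟨sB, fun _ h => h.elim, ?_, fun _ _ h => h.elim⟩
    intro E hEA hEB
    have hEB' : E ≠ B := hEB.ne
    have := tw hEA hEB'
    unfold Arr at hEB ⊢
    rw [s1 _ _ (fun h => hne h.2.symm)] at hEB
    have h2 := this.1.2 hEB
    rw [s1 E A (fun h => hEB' h.1), s1 A E (fun h => hne h.1), s1 B E (fun h => hEA h.2)]
    exact ⟨h2, Or.inl (this.2 h2).symm⟩
  have g2 : ∀ C, M1.DirEdge C B → M1.DirEdge C A := by
    intro C hCB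
    have hCA : C ≠ A := by rintro rfl; exact hCB.not_arr sB
    have hCB' : C ≠ B := hCB.ne
    obtain ⟨h2, h3⟩ := f2.k1 C hCA hCB.arr
    rcases h3 with h3 | h3
    · exact ⟨h2, by rw [h3]; exact hCB.2⟩
    · exact h3.elim
  obtain ⟨m2, e2⟩ := flip_tail m1 f2 sA g2
  set M2 := M1.setMark A B Mark.tail sA.adj with hM2
  have s2 : ∀ a b, ¬ (a = A ∧ b = B) → M2.mark a b = M1.mark a b := fun a b h => setMark_same h
  have hfin : ∀ a b, ¬ (a = A ∧ b = B) → ¬ (a = B ∧ b = A) → M2.mark a b = M.mark a b :=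
    fun a b h h' => (s2 a b h).trans (s1 a b h')
  have hdir : M2.DirEdge B A := ⟨by rw [s2 _ _ (fun h => hne h.1.symm)]; exact sB, setMark_self⟩
  refine ⟨M2, c.closed M1 hM1c _ m2 e2, ?_, hdir, hfin⟩
  intro a b hab
  have n1 : ¬ (a = A ∧ b = B) := by
    rintro ⟨rfl, rfl⟩; exact hdir.not_arr hab.1
  have n2 : ¬ (a = B ∧ b = A) := by
    rintro ⟨rfl, rfl⟩; exact hdir.not_arr hab.2
  refine h1 a b ⟨?_, ?_⟩
  · rw [← hfin a b n1 n2]; exact hab.1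
  · rw [← hfin b a (fun h => n2 ⟨h.2, h.1⟩) (fun h => n1 ⟨h.2, h.1⟩)]; exact hab.2

theorem Ctx.noUnshield (c : Ctx cls ad S) {M : PMG V} (hM : M ∈ cls) (h1 : S1 ad S M) {a b d : V}
    (ha : HE ad S M a d) (hb : HE ad S M b d) (hab : a ≠ b) : HE ad S M a b ∨ HE ad S M b a := by
  have had := c.adj M hM
  have hadab : ad a b := by
    by_contra hcon
    exact ha.2 (c.J_coll hM ha.1.arr hb.1.arr hab hcon)
  have n1 : ¬ J ad S a b := fun g =>
    ha.2 (c.cp g ((had _ _).1 ha.1.adj) ((had _ _).1 hb.1.adj)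
      (fun g => hb.1.not_arr (c.sound g hM)))
  have n2 : ¬ J ad S b a := fun g =>
    hb.2 (c.cp g ((had _ _).1 hb.1.adj) ((had _ _).1 ha.1.adj)
      (fun g => ha.1.not_arr (c.sound g hM)))
  rcases (c.anc hM).mixed a b ((had _ _).2 hadab) with g | g | g
  · exact Or.inl ⟨g, n1⟩
  · exact Or.inr ⟨g, n2⟩
  · exact absurd (h1 a b g) n2

/-- number of unforced edges from outside `K` into `K`. -/
noncomputable def nIn [Fintype V] (ad : V → V → Prop) (S : V → V → Finset V → Prop) (K : Set V)
    (M : PMG V) : ℕ :=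
  (Finset.univ.filter (fun p : V × V => HE ad S M p.1 p.2 ∧ p.1 ∉ K ∧ p.2 ∈ K)).card

theorem Ctx.claimP [Fintype V] (c : Ctx cls ad S) (C K : Set V) (hKC : K ⊆ C) :
    ∀ (n : ℕ) (M : PMG V), M ∈ cls → S1 ad S M → nIn ad S K M = n →
      (∀ a b, b ∈ C → HE ad S M a b → a ∈ C) →
      (∀ a b, a ∈ C → b ∈ C → a ≠ b → HE ad S M a b ∨ HE ad S M b a) →
      ∃ M' ∈ cls, S1 ad S M' ∧ Agr M M' C ∧ (∀ a b, b ∈ K → HE ad S M' a b → a ∈ K) := by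
  intro n
  induction n using Nat.strong_induction_on with
  | _ n ih =>
  intro M hM h1 hn hcl hcq
  by_cases hdone : ∀ a b, b ∈ K → HE ad S M a b → a ∈ K
  · exact ⟨M, hM, h1, fun _ _ _ => rfl, hdone⟩
  have hA := c.anc hM
  have hex : ∃ b, b ∈ K ∧ ∃ a, a ∉ K ∧ HE ad S M a b := by
    push Not at hdone
    obtain ⟨a, b, g1, g2, g3⟩ := hdone
    exact ⟨b, g1, a, g3, g2⟩
  obtain ⟨b, ⟨hbK, hb⟩, hbmin⟩ := hA.wf.has_min {b | b ∈ K ∧ ∃ a, a ∉ K ∧ HE ad S M a b} hex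
  obtain ⟨a, ⟨haK, hab⟩, hamax⟩ := hA.wf'.has_min {a | a ∉ K ∧ HE ad S M a b} hb
  have hbC := hKC hbK
  have haC := hcl a b hbC hab
  have hc1 : ∀ d, HE ad S M d a → HE ad S M d b := by
    intro d hda
    have hdC := hcl d a haC hda
    have hdb : d ≠ b := by
      rintro rfl; exact hda.1.not_arr hab.1.arr
    rcases hcq d b hdC hbC hdb with g | g
    · exact g
    · exact absurd (((Relation.TransGen.single g.1).tail hda.1).tail hab.1) (hA.acyc b)
  have hc2 : ∀ d, d ≠ a → HE ad S M d b → HE ad S M d a := by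
    intro d hda hdb
    rcases hcq d a (hcl d b hbC hdb) haC hda with g | g
    · exact g
    · by_cases hdK : d ∈ K
      · exact absurd (Relation.TransGen.single hdb.1) (hbmin d ⟨hdK, a, haK, g⟩)
      · exact absurd (Relation.TransGen.single g.1) (hamax d ⟨hdK, hdb⟩)
  obtain ⟨M', hM', h1', hdir, hsame⟩ := c.reverse hM h1 hab hc1 hc2
  have hba : ¬ J ad S b a := fun g => hab.1.not_arr (c.sound g hM)
  have hhe : ∀ u w, ¬ (u = a ∧ w = b) → ¬ (u = b ∧ w = a) → (HE ad S M' u w ↔ HE ad S M u w) := by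
    intro u w g1 g2
    unfold HE DirEdge
    rw [hsame u w g1 g2, hsame w u (fun h => g2 ⟨h.2, h.1⟩) (fun h => g1 ⟨h.2, h.1⟩)]
  have hnab : ¬ HE ad S M' a b := fun g => g.1.not_arr hdir.arr
  have hagr : Agr M M' C := by
    intro u w huw
    apply hsame
    · rintro ⟨rfl, rfl⟩; exact huw ⟨haC, hbC⟩
    · rintro ⟨rfl, rfl⟩; exact huw ⟨hbC, haC⟩
  have hlt : nIn ad S K M' < n := by
    rw [← hn]
    unfold nIn
    apply Finset.card_lt_card
    rw [Finset.ssubset_iff_of_subset]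
    · exact ⟨(a, b), by simp [hab, haK, hbK], by simp [hnab]⟩
    · rintro ⟨u, w⟩ h
      simp only [Finset.mem_filter, Finset.mem_univ, true_and] at h ⊢
      refine ⟨?_, h.2⟩
      have g1 : ¬ (u = a ∧ w = b) := by rintro ⟨rfl, rfl⟩; exact hnab h.1
      have g2 : ¬ (u = b ∧ w = a) := by rintro ⟨rfl, rfl⟩; exact h.2.1 hbK
      exact (hhe u w g1 g2).1 h.1
  have q1 : ∀ u w, w ∈ C → HE ad S M' u w → u ∈ C := by
    intro u w hw huw
    by_cases g2 : u = b ∧ w = a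
    · rw [g2.1]; exact hbC
    · have g1 : ¬ (u = a ∧ w = b) := by rintro ⟨rfl, rfl⟩; exact hnab huw
      exact hcl u w hw ((hhe u w g1 g2).1 huw)
  have q2 : ∀ u w, u ∈ C → w ∈ C → u ≠ w → HE ad S M' u w ∨ HE ad S M' w u := by
    intro u w hu hw huw
    by_cases g1 : u = a ∧ w = b
    · obtain ⟨rfl, rfl⟩ := g1; exact Or.inr ⟨hdir, hba⟩
    · by_cases g2 : u = b ∧ w = a
      · obtain ⟨rfl, rfl⟩ := g2; exact Or.inl ⟨hdir, hba⟩
      · rw [hhe u w g1 g2, hhe w u (fun h => g2 ⟨h.2, h.1⟩) (fun h => g1 ⟨h.2, h.1⟩)]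
        exact hcq u w hu hw huw
  obtain ⟨M'', hM'', h1'', ha'', hK''⟩ := ih _ hlt M' hM' h1' rfl q1 q2
  exact ⟨M'', hM'', h1'', hagr.trans ha'', hK''⟩

theorem Ctx.claimS [Fintype V] (c : Ctx cls ad S) :
    ∀ (n : ℕ) (Q : Finset V) (K : Set V) (M : PMG V), Q.card = n → M ∈ cls → S1 ad S M →
      (∀ a b, b ∈ Q → HE ad S M a b → a ∈ Q) → (∀ a ∈ K, a ∈ Q) →
      (∀ a b, a ∈ K → b ∈ K → a ≠ b → HE ad S M a b ∨ HE ad S M b a) →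
      ∃ M' ∈ cls, S1 ad S M' ∧ Agr M M' {a | a ∈ Q} ∧
        (∀ a b, b ∈ K → HE ad S M' a b → a ∈ K) := by
  intro n
  induction n with
  | zero =>
    intro Q K M hQ hM h1 _ hK _
    refine ⟨M, hM, h1, fun _ _ _ => rfl, ?_⟩
    intro a b hb
    have := hK b hb
    rw [Finset.card_eq_zero.1 hQ] at this
    simp at this
  | succ n ih =>
    intro Q K M hQ hM h1 hcl hK hcq
    have hA := c.anc hM
    have hne : ∃ l, l ∈ Q := by
      have : 0 < Q.card := by omega
      exact Finset.card_pos.1 this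
    obtain ⟨l, hl, hlmax⟩ := hA.wf'.has_min {l | l ∈ Q} hne
    have hsink : ∀ d, d ∈ Q → ¬ HE ad S M l d := fun d hd g =>
      hlmax d hd (Relation.TransGen.single g.1)
    have hcard : (Q.erase l).card = n := by rw [Finset.card_erase_of_mem hl]; omega
    have hcl' : ∀ a b, b ∈ Q.erase l → HE ad S M a b → a ∈ Q.erase l := by
      intro a b hb hab
      have hbQ := Finset.mem_of_mem_erase hb
      refine Finset.mem_erase.2 ⟨?_, hcl a b hbQ hab⟩
      rintro rfl; exact hsink b hbQ hab
    have hsub : {a | a ∈ Q.erase l} ⊆ {a | a ∈ Q} := fun a ha => Finset.mem_of_mem_erase ha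
    by_cases hlK : l ∈ K
    · have hN : ∀ a ∈ {a | HE ad S M a l}, a ∈ Q.erase l := by
        intro a ha
        exact Finset.mem_erase.2 ⟨ha.1.ne, hcl a l hl ha⟩
      obtain ⟨M', hM', h1', hagr, hNcl⟩ := ih (Q.erase l) {a | HE ad S M a l} M hcard hM h1 hcl' hN
        (fun a b ha hb hab => c.noUnshield hM h1 ha hb hab)
      have hl' : ∀ a, HE ad S M' a l ↔ HE ad S M a l := fun a =>
        hagr.he (fun h => Finset.notMem_erase l Q h.2)
      have hl'' : ∀ a, HE ad S M' l a ↔ HE ad S M l a := fun a =>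
        hagr.he (fun h => Finset.notMem_erase l Q h.1)
      have hKC : K ⊆ insert l {a | HE ad S M a l} := by
        intro a ha
        by_cases hal : a = l
        · exact Or.inl hal
        · right
          rcases hcq a l ha hlK hal with g | g
          · exact g
          · exact absurd g (hsink a (hK a ha))
      have q1 : ∀ a b, b ∈ insert l {a | HE ad S M a l} → HE ad S M' a b →
          a ∈ insert l {a | HE ad S M a l} := by
        rintro a b (rfl | hb) hab
        · right; exact (hl' a).1 hab
        · right; exact hNcl a b hb hab
      have q2 : ∀ a b, a ∈ insert l {a | HE ad S M a l} → b ∈ insert l {a | HE ad S M a l} →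
          a ≠ b → HE ad S M' a b ∨ HE ad S M' b a := by
        rintro a b (rfl | ha) (rfl | hb) hab
        · exact absurd rfl hab
        · right; exact (hl' b).2 hb
        · left; exact (hl' a).2 ha
        · exact c.noUnshield hM' h1' ((hl' a).2 ha) ((hl' b).2 hb) hab
      obtain ⟨M'', hM'', h1'', hagr2, hKcl⟩ := c.claimP (insert l {a | HE ad S M a l}) K hKC _ M'
        hM' h1' rfl q1 q2
      refine ⟨M'', hM'', h1'', (hagr.mono hsub).trans (hagr2.mono ?_), hKcl⟩
      rintro a (rfl | ha)
      · exact hl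
      · exact hsub (hN a ha)
    · obtain ⟨M', hM', h1', hagr, hKcl⟩ := ih (Q.erase l) K M hcard hM h1 hcl'
        (fun a ha => Finset.mem_erase.2 ⟨fun h => hlK (h ▸ ha), hK a ha⟩) hcq
      exact ⟨M', hM', h1', hagr.mono hsub, hKcl⟩

theorem Ctx.exists_S2 [Fintype V] (c : Ctx cls ad S) (x : V) :
    ∃ M ∈ cls, S1 ad S M ∧ ∀ a, M.Arr a x → J ad S a x := by
  obtain ⟨M, hM, h1⟩ := c.exists_S1
  obtain ⟨M', hM', h1', _, hK⟩ := c.claimS _ Finset.univ {x} M rfl hM h1 (by simp) (by simp)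
    (by rintro a b rfl rfl h; exact absurd rfl h)
  refine ⟨M', hM', h1', ?_⟩
  intro a ha
  by_contra hJ
  have hdir : M'.DirEdge a x := by
    refine (c.anc hM').mixed.dir_of_not_arr ha.adj ?_
    intro g; exact hJ (h1' x a ⟨g, ha⟩)
  exact ha.ne (hK a x rfl ⟨hdir, hJ⟩)

end PMG
namespace PMG

variable {V : Type}
variable {cls : Set (PMG V)} {ad : V → V → Prop} {S : V → V → Finset V → Prop}

/-! ### Visibility -/

/-- `VP R U x d l`: the path `d :: l` is a collider path into `x` (with arrowheads given by `R`)
whose inner nodes satisfy `U`. -/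
inductive VP (R : V → V → Prop) (U : V → Prop) (x : V) : V → List V → Prop
  | base {d : V} (h : R d x) : VP R U x d [x]
  | step {d q q' : V} {l : List V} (h1 : R d q) (h2 : R q' q) (hU : U q)
      (h : VP R U x q (q' :: l)) : VP R U x d (q :: q' :: l)

theorem VP.mono {R R' : V → V → Prop} {U U' : V → Prop} {x d : V} {l : List V}
    (h : VP R U x d l) (hR : ∀ a b, R a b → R' a b) (hU : ∀ c ∈ l, U c → U' c) :
    VP R' U' x d l := by
  induction h with
  | base h => exact VP.base (hR _ _ h)
  | step h1 h2 hq h ih =>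
    exact VP.step (hR _ _ h1) (hR _ _ h2) (hU _ (by simp) hq)
      (ih (fun c hc => hU c (List.mem_cons_of_mem _ hc)))

theorem VP.chg {R : V → V → Prop} {U : V → Prop} {x d d' q : V} {l : List V}
    (h : VP R U x d (q :: l)) (hd : R d' q) : VP R U x d' (q :: l) := by
  cases h with
  | base h => exact VP.base hd
  | step h1 h2 hq h => exact VP.step hd h2 hq h

theorem VP.hd {R : V → V → Prop} {U : V → Prop} {x d q : V} {l : List V}
    (h : VP R U x d (q :: l)) : R d q := by
  cases h <;> assumption

theorem VP.mem_x {R : V → V → Prop} {U : V → Prop} {x d : V} {l : List V}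
    (h : VP R U x d l) : x ∈ l := by
  induction h with
  | base h => simp
  | step h1 h2 hq h ih => exact List.mem_cons_of_mem _ ih

theorem vp_of_list {G : PMG V} {x u : V} : ∀ (l : List V) (v : V), l ≠ [] →
    (v :: l).Nodup → (v :: l).getLast? = some x →
    (∀ i, i + 2 < (v :: l).length → ColliderAt G (v :: l) i) →
    (∃ a, (v :: l)[(v :: l).length - 2]? = some a ∧ G.mark a x = some Mark.arrow) →
    (∀ c ∈ l, c ≠ x → G.DirEdge c u) → VP G.Arr (fun c => G.DirEdge c u) x v l := by
  intro l
  induction l with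
  | nil => intro v h; exact absurd rfl h
  | cons q l ih =>
    intro v _ hnd hl hcol ha hU
    cases l with
    | nil =>
      simp at hl ha
      subst hl
      exact VP.base ha
    | cons q' l =>
      obtain ⟨a, b, e, g1, g2, g3, g4, g5⟩ := hcol 0 (by simp)
      simp at g1 g2 g3
      subst g1; subst g2; subst g3
      have hqx : q ≠ x := by
        rintro rfl
        have : q ∈ q' :: l := by
          apply List.mem_of_getLast? (l := q' :: l)
          simpa using hl
        exact (List.nodup_cons.1 (List.nodup_cons.1 hnd).2).1 this
      refine VP.step g4 g5 (hU q (by simp) hqx) (ih q (by simp) (List.nodup_cons.1 hnd).2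
        (by simpa using hl) ?_ ?_ (fun c hc => hU c (List.mem_cons_of_mem _ hc)))
      · intro i hi
        obtain ⟨a, b, e, g1, g2, g3, g4, g5⟩ := hcol (i+1) (by simp at hi ⊢; omega)
        exact ⟨a, b, e, by simpa using g1, by simpa using g2, by simpa using g3, g4, g5⟩
      · obtain ⟨a, h1, h2⟩ := ha
        refine ⟨a, ?_, h2⟩
        have e1 : (v :: q :: q' :: l).length - 2 = (l.length) + 1 := by simp
        have e2 : (q :: q' :: l).length - 2 = l.length := by simp
        rw [e1] at h1; rw [e2]
        simpa using h1

theorem VP.colliderPath {G : PMG V} {x u d : V} {l : List V}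
    (h : VP G.Arr (fun c => G.DirEdge c u) x d l) (hnd : (d :: l).Nodup) :
    ColliderPathInto G d x u := by
  have key : l ≠ [] ∧ (d :: l).IsChain G.Adj ∧ (d :: l).getLast? = some x ∧
      (∀ i, i + 2 < (d :: l).length → ColliderAt G (d :: l) i) ∧
      (∃ a, (d :: l)[(d :: l).length - 2]? = some a ∧ G.mark a x = some Mark.arrow) ∧
      (∀ c ∈ l, c ≠ x → G.DirEdge c u) := by
    clear hnd
    induction h with
    | @base d h =>
      refine ⟨by simp, List.isChain_cons_cons.2 ⟨Arr.adj h, List.isChain_singleton _⟩, by simp, ?_,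
        ⟨d, by simp, h⟩, by simp⟩
      intro i hi; simp at hi
    | @step d q q' l h1 h2 hq h ih =>
      obtain ⟨_, i2, i3, i4, ⟨a, i5, i5'⟩, i6⟩ := ih
      refine ⟨by simp, List.isChain_cons_cons.2 ⟨Arr.adj h1, i2⟩, by simpa using i3, ?_,
        ⟨a, ?_, i5'⟩, ?_⟩
      · intro i hi
        cases i with
        | zero => exact ⟨d, q, q', by simp, by simp, by simp, h1, h2⟩
        | succ i =>
          obtain ⟨a, b, e, g1, g2, g3, g4, g5⟩ := i4 i (by simp at hi ⊢; omega)
          exact ⟨a, b, e, by simpa using g1, by simpa using g2, by simpa using g3, g4, g5⟩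
      · have e1 : (d :: q :: q' :: l).length - 2 = (l.length) + 1 := by simp
        have e2 : (q :: q' :: l).length - 2 = l.length := by simp
        rw [e2] at i5; rw [e1]
        simpa using i5
      · intro c hc hcx
        rcases List.mem_cons.1 hc with rfl | hc
        · exact hq
        · exact i6 c hc hcx
  obtain ⟨k1, k2, k3, k4, k5, k6⟩ := key
  refine ⟨d :: l, ⟨⟨by simp, hnd, k2⟩, by simp, k3, ?_⟩, k4, k5, ?_⟩
  · cases l with
    | nil => exact absurd rfl k1
    | cons => simp
  · intro c hc hcd hcx
    exact k6 c ((List.mem_cons.1 hc).resolve_left hcd) hcx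

theorem visible_iff {G : PMG V} {x u : V} : Visible G x u ↔ G.DirEdge x u ∧
    ∃ d l, d ≠ u ∧ ¬ G.Adj d u ∧ VP G.Arr (fun c => G.DirEdge c u) x d l ∧ (d :: l).Nodup := by
  constructor
  · rintro ⟨h0, v, h1, h2, h3⟩
    refine ⟨h0, ?_⟩
    rcases h3 with h3 | ⟨p, ⟨⟨g1, g2, g3⟩, g4, g5, g6⟩, g7, g8, g9⟩
    · exact ⟨v, [x], h1, h2, VP.base h3, by simpa using Arr.ne (G := G) h3⟩
    · match p, g1, g2, g3, g4, g5, g6, g7, g8, g9 with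
      | [], g1, _, _, _, _, _, _, _, _ => exact absurd rfl g1
      | w :: l, g1, g2, g3, g4, g5, g6, g7, g8, g9 =>
        simp at g4; subst g4
        refine ⟨w, l, h1, h2, vp_of_list l w ?_ g2 g5 g7 g8 ?_, g2⟩
        · rintro rfl; simp at g6
        · intro c hc hcx
          refine g9 c (List.mem_cons_of_mem _ hc) ?_ hcx
          rintro rfl; exact (List.nodup_cons.1 g2).1 hc
  · rintro ⟨h0, d, l, h1, h2, h3, h4⟩
    exact ⟨h0, d, h1, h2, Or.inr (h3.colliderPath h4)⟩

/-- all arrowheads on the path can be made forced ones. -/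
theorem Ctx.vpJ (c : Ctx cls ad S) {M : PMG V} (hM : M ∈ cls) (h1 : S1 ad S M) {x : V}
    (h2 : ∀ a, M.Arr a x → J ad S a x) {U : V → Prop} {d : V} {l : List V}
    (h : VP M.Arr U x d l) (hnd : (d :: l).Nodup) :
    ∃ n l', (n :: l').Sublist l ∧ VP (J ad S) U x d (n :: l') ∧
      ∀ q, l.head? = some q → M.Arr q d → J ad S n d := by
  have hA := c.anc hM
  induction h with
  | @base d h =>
    refine ⟨x, [], List.Sublist.refl _, VP.base (h2 d h), ?_⟩
    intro q hq hqd
    simp at hq; subst hq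
    exact h1 d x ⟨h, hqd⟩
  | @step d q q' l g1 g2 hU h ih =>
    obtain ⟨n, l', hs, hv, hb⟩ := ih (List.nodup_cons.1 hnd).2
    have hJn : J ad S n q := hb q' (by simp) g2
    by_cases hJ : J ad S d q
    · refine ⟨q, n :: l', List.Sublist.cons_cons q hs, VP.step hJ hJn hU hv, ?_⟩
      intro w hw hwd
      simp at hw; subst hw
      exact h1 d q ⟨g1, hwd⟩
    · have hdq : M.DirEdge d q := by
        refine hA.mixed.dir_of_not_arr g1.adj ?_
        intro g; exact hJ (h1 q d ⟨g, g1⟩)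
      have hdn : d ≠ n := by
        rintro rfl
        exact (List.nodup_cons.1 hnd).1 (List.mem_cons_of_mem _ (hs.subset (by simp)))
      have hJnd : J ad S n d := by
        refine c.cp1 hJn ((c.adj M hM _ _).1 g1.adj) hJ ?_ hdn
        intro hT
        exact (c.soundT hT hM).not_arr g1
      have hJqn : J ad S q n := hv.hd
      have hdn' : M.Arr d n := hA.r2a hdq (c.sound hJqn hM)
        ((c.adj M hM _ _).2 (c.ad_symm hJnd.adj))
      have hJdn : J ad S d n := h1 n d ⟨c.sound hJnd hM, hdn'⟩
      exact ⟨n, l', hs.trans (List.sublist_cons_self _ _), hv.chg hJdn, fun _ _ _ => hJnd⟩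

/-- tails on the inner nodes are common to the class. -/
theorem Ctx.vp_tails (c : Ctx cls ad S) {M M' : PMG V} (hM : M ∈ cls) (hM' : M' ∈ cls) {x u D : V}
    (hDu : D ≠ u) (hnD : ¬ ad D u) (hxu : M.DirEdge x u) {d : V} {l : List V}
    (h : VP (J ad S) (fun c => M.DirEdge c u) x d l)
    (hd : ∀ q, l.head? = some q → ∀ Z, (∃ n v, DW M' Z n D v d q) ∨ WConn M' Z D u) :
    ∀ q ∈ l, M'.DirEdge q u := by
  have hA' := c.anc hM'
  obtain ⟨Z0, hZ0⟩ := c.S_ex hDu hnD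
  have key : ∀ {d q : V}, J ad S d q → M.DirEdge q u →
      (∀ Z, (∃ n v, DW M' Z n D v d q) ∨ WConn M' Z D u) → M'.DirEdge q u := by
    intro d q hdq hqu hw
    have hadq : ad q u := (c.adj M hM _ _).1 hqu.adj
    refine hA'.mixed.dir_of_not_arr ((c.adj M' hM' _ _).2 hadq) ?_
    intro huq
    have hqD : q ≠ D := by rintro rfl; exact hnD hadq
    have hs := c.S_add hM hZ0 hqu (Or.inr (Or.inr rfl)) hqD hqu.ne
    have hns := ((c.sep M' hM' _ _ _).1 hs).2.2.2
    rcases hw (insert q Z0) with ⟨n, v, g⟩ | g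
    · refine hns ⟨_, _, _, g.snoc (q := u) ⟨(c.sound hdq hM').adj, huq.adj.symm, ?_⟩⟩
      simp [c.sound hdq hM', huq]
    · exact hns g
  induction h with
  | @base d h =>
    intro q hq
    simp at hq; subst hq
    exact key h hxu (hd q (by simp))
  | @step d q q' l g1 g2 hU h ih =>
    have hq := key g1 hU (hd q (by simp))
    intro w hw
    rcases List.mem_cons.1 hw with rfl | hw
    · exact hq
    · refine ih ?_ w hw
      intro e he Z
      simp at he; subst he
      rcases hd q (by simp) Z with ⟨n, v, g⟩ | g
      · by_cases hqZ : q ∈ Z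
        · refine Or.inl ⟨_, _, g.snoc ⟨(c.sound g1 hM').adj, (c.sound g2 hM').adj.symm, ?_⟩⟩
          simp [hqZ, c.sound g1 hM', c.sound g2 hM']
        · refine Or.inr ⟨_, _, _, g.snoc (q := u) ⟨(c.sound g1 hM').adj, hq.adj, ?_⟩⟩
          simp [hqZ, hq.not_arr]
      · exact Or.inr g

theorem Ctx.arrP {P : PMG V} (hP : IsPAGOf P cls) (c : Ctx cls P.Adj S) {a b : V}
    (h : J P.Adj S a b) : P.Arr a b :=
  (hP.2.2.2.2.2.1 a b).2 ⟨h.adj, fun _ hM => c.sound h hM⟩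

theorem dirP {P : PMG V} (hP : IsPAGOf P cls) {a b : V}
    (h : ∀ M ∈ cls, M.DirEdge a b) : P.DirEdge a b := by
  obtain ⟨M0, h0⟩ := hP.1
  have had : P.Adj a b := (hP.2.2.2.2.1 M0 h0 a b).2 (h M0 h0).adj
  exact ⟨(hP.2.2.2.2.2.1 a b).2 ⟨had, fun M hM => (h M hM).1⟩,
    (hP.2.2.2.2.2.2 b a).2 ⟨had.symm, fun M hM => (h M hM).2⟩⟩

theorem Ctx.visible_P {P : PMG V} (hP : IsPAGOf P cls) (c : Ctx cls P.Adj S) {M : PMG V}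
    (hM : M ∈ cls) (h1 : S1 P.Adj S M) {x : V} (h2 : ∀ a, M.Arr a x → J P.Adj S a x) {u : V}
    (hv : Visible M x u) : Visible P x u := by
  rw [visible_iff] at hv ⊢
  obtain ⟨hxu, d, l, hdu, hnd, hvp, hnodup⟩ := hv
  rw [c.adj M hM] at hnd
  obtain ⟨n, l', hs, hvJ, _⟩ := c.vpJ hM h1 h2 hvp hnodup
  have htails : ∀ q ∈ n :: l', P.DirEdge q u := by
    intro q hq
    refine dirP hP ?_
    intro M' hM'
    refine c.vp_tails hM hM' hdu hnd hxu hvJ ?_ q hq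
    intro e he Z
    simp at he; subst he
    exact Or.inl ⟨0, _, DW.refl _ _ (c.sound hvJ.hd hM').adj⟩
  refine ⟨htails x hvJ.mem_x, d, n :: l', hdu, hnd, ?_, ?_⟩
  · exact hvJ.mono (fun a b h => c.arrP hP h) (fun q hq _ => htails q hq)
  · exact (List.Sublist.cons_cons d hs).nodup hnodup

end PMG
namespace PMG

variable {V : Type}
variable {cls : Set (PMG V)} {ad : V → V → Prop} {S : V → V → Finset V → Prop}

/-! ### Visible edges along a shortest path -/

theorem visible_of_P {P : PMG V} (hP : IsPAGOf P cls) {M : PMG V} (hM : M ∈ cls) {x u : V}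
    (h : Visible P x u) : Visible M x u := by
  rw [visible_iff] at h ⊢
  have hA : ∀ a b, P.Arr a b → M.Arr a b := fun a b h =>
    ((hP.2.2.2.2.2.1 a b).1 h).2 M hM
  have hD : ∀ a b, P.DirEdge a b → M.DirEdge a b := fun a b h =>
    ⟨hA a b h.1, ((hP.2.2.2.2.2.2 b a).1 h.2).2 M hM⟩
  obtain ⟨h0, d, l, h1, h2, h3, h4⟩ := h
  exact ⟨hD _ _ h0, d, l, h1, fun h => h2 ((hP.2.2.2.2.1 M hM _ _).2 h),
    h3.mono hA (fun c _ h => hD _ _ h), h4⟩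

theorem special_dichotomy {M : PMG V} (hA : Anc M) {x u1 u2 : V} (hx : M.DirEdge x u1)
    (hnv : ¬ Visible M x u1) (h21 : M.Arr u2 u1) {d : V} {l : List V}
    (h : VP M.Arr (fun c => M.DirEdge c u2) x d l) (hnd : (d :: l).Nodup) :
    ∃ q, l.head? = some q ∧ M.Arr d q ∧
      ((∀ Z : Finset V, u1 ∈ Z → ∀ E', M.Arr E' q → ∃ n w, DW M Z n E' q w u2) ∨
        ∀ c ∈ l, M.DirEdge c u1) := by
  have NV : ∀ d l, VP M.Arr (fun c => M.DirEdge c u1) x d l → (d :: l).Nodup → d ≠ u1 →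
      M.Adj d u1 := by
    intro d l h1 h2 h3
    by_contra h4
    exact hnv (visible_iff.2 ⟨hx, d, l, h3, h4, h1, h2⟩)
  induction h with
  | @base d h =>
    refine ⟨x, rfl, h, Or.inr ?_⟩
    intro c hc
    simp at hc; subst hc; exact hx
  | @step d q q' l g1 g2 hU h ih =>
    obtain ⟨r, hr, hqr, ih⟩ := ih (List.nodup_cons.1 hnd).2
    simp at hr; subst hr
    refine ⟨q, rfl, g1, ?_⟩
    have out : ∀ Z : Finset V, q ∉ Z → ∀ E', M.Arr E' q → ∃ n w, DW M Z n E' q w u2 := by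
      intro Z hq E' hE
      exact ⟨_, _, Tri.dw ⟨hE.adj, hU.adj, by simp [hq, hU.not_arr]⟩⟩
    rcases ih with ih | ih
    · left
      intro Z hZ E' hE
      by_cases hq : q ∈ Z
      · obtain ⟨n, w, hw⟩ := ih Z hZ q hqr
        have t : Tri M Z E' q q' := ⟨hE.adj, g2.adj.symm, by simp [hq, hE, g2]⟩
        exact ⟨_, _, t.dw.append hw⟩
      · exact out Z hq E' hE
    · have hq1 : q ≠ u1 := by
        rintro rfl; exact hU.not_arr h21
      have hadj : M.Adj q u1 := NV q (q' :: l) (h.mono (fun _ _ h => h) (fun c hc _ => ih c hc))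
        (List.nodup_cons.1 hnd).2 hq1
      by_cases h1q : M.Arr u1 q
      · left
        have hq1' : M.Arr q u1 := by
          by_contra hn
          have h1 := hA.mixed.dir_of_not_arr hadj.symm hn
          exact (hA.r2c h1 hU h21.adj.symm).not_arr h21
        intro Z hZ E' hE
        by_cases hq : q ∈ Z
        · have t : Tri M Z E' q u1 := ⟨hE.adj, hadj, by simp [hq, hE, h1q]⟩
          exact ⟨_, _, t.dw.snoc ⟨hadj, h21.adj.symm, by simp [hZ, hq1', h21]⟩⟩
        · exact out Z hq E' hE
      · right
        intro c hc
        rcases List.mem_cons.1 hc with rfl | hc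
        · exact hA.mixed.dir_of_not_arr hadj h1q
        · exact ih c hc

theorem Ctx.special (c : Ctx cls ad S) {M : PMG V} (hM : M ∈ cls) {x u1 u2 : V}
    (hx : M.DirEdge x u1) (hnv : ¬ Visible M x u1) (hv : Visible M x u2)
    (hJ : ¬ J ad S u2 u1) : ¬ M.Arr u2 u1 := by
  intro h21
  have hA := c.anc hM
  obtain ⟨_, D, l, hD, hnD, hvp, hnd⟩ := visible_iff.1 hv
  have hD1 : D ≠ u1 := by
    rintro rfl; exact hnD h21.adj.symm
  obtain ⟨q, hq, hDq, hdi⟩ := special_dichotomy hA hx hnv h21 hvp hnd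
  have hqm : q ∈ l := List.mem_of_head? hq
  have hcon : ∀ Z : Finset V, u1 ∈ Z → WConn M Z D u2 := by
    intro Z hZ
    rcases hdi with h | h
    · obtain ⟨n, w, hw⟩ := h Z hZ D hDq
      exact ⟨_, _, _, hw⟩
    · have hadj : M.Adj D u1 := by
        by_contra h4
        exact hnv (visible_iff.2 ⟨hx, D, l, hD1, h4,
          hvp.mono (fun _ _ h => h) (fun c hc _ => h c hc), hnd⟩)
      refine excl_lemma ?_ h21 hZ
      by_contra hn
      have h1 := hA.mixed.dir_of_not_arr hadj.symm hn
      exact (hA.r2c (h q hqm) h1 hDq.adj.symm).not_arr hDq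
  have hnad : ¬ ad D u2 := fun h => hnD ((c.adj M hM _ _).2 h)
  obtain ⟨Z, hZ⟩ := c.S_ex hD hnad
  refine hJ (J.rs hD hnad hZ (Or.inr (Or.inr rfl)) hD1.symm h21.ne.symm ?_
    ((c.adj M hM _ _).1 h21.adj))
  intro Z' hZ' h1
  exact ((c.sep M hM _ _ _).1 hZ').2.2.2 (hcon Z' h1)

end PMG

open PMG in
/-- If a possibly directed path `p` from `x` to `y` in a PAG does not start with a
visible edge out of `x`, then some MAG in the equivalence class orients a subsequence
of `p` as a directed path from `x` to `y` starting with an invisible edge. -/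
theorem exists_mag_with_invisible_directed_subsequence {V : Type} [Fintype V] [DecidableEq V]
    (P : PMG V) (cls : Set (PMG V)) (hP : IsPAGOf P cls) (x y : V) (p : List V)
    (hpath : IsPathFromTo P p x y) (hpd : PossDirAlong P p)
    (hnotvis : ¬ StartsVisible (Visible P) p) :
    ∃ M ∈ cls, ∃ q : List V, q.Sublist p ∧
      q.head? = some x ∧ q.getLast? = some y ∧
      IsPath M q ∧ DirectedAlong M q ∧
      ∃ a b, q[0]? = some a ∧ q[1]? = some b ∧ M.DirEdge a b ∧ ¬ Visible M a b := by
  obtain ⟨S, c⟩ := hP.ctx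
  obtain ⟨M, hM, h1, h2⟩ := c.exists_S2 x
  have hA := c.anc hM
  obtain ⟨⟨hp0, hpn, hpc⟩, hph, hpl, hplen⟩ := hpath
  have hpc' : p.IsChain P.Adj := hpc
  have hchain : p.IsChain (fun a b => P.Adj a b ∧ ¬ J P.Adj S b a) := by
    rw [List.isChain_iff_getElem] at hpc' ⊢
    intro i hi
    refine ⟨hpc' i hi, fun hJ => ?_⟩
    exact hpd i _ _ (List.getElem?_eq_getElem _) (List.getElem?_eq_getElem _) (c.arrP hP hJ)
  have hex : ∃ k, ∃ q : List V, q.length = k ∧ q.Sublist p ∧ q.head? = some x ∧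
      q.getLast? = some y ∧ 2 ≤ q.length ∧
      q.IsChain (fun a b => P.Adj a b ∧ ¬ J P.Adj S b a) ∧ ¬ StartsVisible (Visible P) q :=
    ⟨_, p, rfl, List.Sublist.refl _, hph, hpl, hplen, hchain, hnotvis⟩
  obtain ⟨q, hqk, hqs, hqh, hql, hqlen, hqc, hqv⟩ := Nat.find_spec hex
  have hmin : ∀ q' : List V, q'.length < q.length → q'.Sublist p → q'.head? = some x →
      q'.getLast? = some y → 2 ≤ q'.length →
      q'.IsChain (fun a b => P.Adj a b ∧ ¬ J P.Adj S b a) → StartsVisible (Visible P) q' := by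
    intro q' g1 g2 g3 g4 g5 g6
    by_contra g7
    exact Nat.find_min hex (m := q'.length) (by omega) ⟨q', rfl, g2, g3, g4, g5, g6, g7⟩
  have key : ∀ (i : ℕ) (l r : List V) (a b : V), l.length = i → q = l ++ a :: b :: r →
      M.DirEdge a b := by
    intro i
    induction i with
    | zero =>
      intro l r a b hl hq
      obtain rfl := List.eq_nil_of_length_eq_zero hl
      subst hq
      simp at hqh; subst hqh
      have := (List.isChain_cons_cons.1 hqc).1
      exact hA.mixed.dir_of_not_arr ((c.adj M hM _ _).2 this.1) (fun h => this.2 (h2 _ h))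
    | succ i ih =>
      intro l' r b e hl hq
      obtain ⟨l, a, rfl⟩ : ∃ l a, l' = l ++ [a] := by
        rcases List.eq_nil_or_concat l' with h | ⟨l, a, h⟩
        · subst h; simp at hl
        · exact ⟨l, a, by simpa using h⟩
      have hl' : l.length = i := by simpa using hl
      have hq' : q = l ++ a :: b :: e :: r := by simpa using hq
      have hab := ih l (e :: r) a b hl' hq'
      have hqc' := hqc
      rw [hq', List.isChain_append_cons_cons, List.isChain_cons_cons] at hqc'
      obtain ⟨k1, k2, k3, k4⟩ := hqc'
      have hnd : q.Nodup := hqs.nodup hpn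
      have hae : a ≠ e := by
        rintro rfl
        rw [hq'] at hnd
        have := (List.nodup_append.1 hnd).2.1
        simp at this
      refine hA.mixed.dir_of_not_arr ((c.adj M hM _ _).2 k3.1) ?_
      intro heb
      have hade : P.Adj a e := by
        by_contra hn
        exact k3.2 (c.J_coll hM heb hab.arr hae.symm (fun h => hn (c.ad_symm h)))
      have hJea : ¬ J P.Adj S e a := by
        intro hJ
        exact k3.2 (c.cp hJ (c.ad_symm k3.1) k2.1 k2.2)
      have hsv : StartsVisible (Visible P) (l ++ a :: e :: r) := by
        refine hmin _ (by rw [hq']; simp) (List.Sublist.trans ?_ hqs) ?_ ?_ (by simp; omega) ?_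
        · rw [hq']
          exact (List.Sublist.refl l).append ((List.sublist_cons_self b (e :: r)).cons_cons a)
        · rw [← hqh, hq']; cases l <;> simp
        · rw [← hql, hq']; simp
        · rw [List.isChain_append_cons_cons]
          exact ⟨k1, ⟨hade, hJea⟩, k4⟩
      cases l with
      | nil =>
        subst hq'
        simp at hqh; subst hqh
        obtain ⟨a', b', m1, m2, m3⟩ := hsv
        simp at m1 m2; subst m1; subst m2
        refine c.special hM hab ?_ (visible_of_P hP hM m3) k3.2 heb
        intro hv
        exact hqv ⟨a, b, by simp, by simp, c.visible_P hP hM h1 h2 hv⟩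
      | cons z l =>
        apply hqv
        obtain ⟨a', b', m1, m2, m3⟩ := hsv
        refine ⟨a', b', ?_, ?_, m3⟩
        · rw [hq', ← m1]; simp
        · rw [hq', ← m2]; cases l <;> simp
  have hdir : ∀ i a b, q[i]? = some a → q[i+1]? = some b → M.DirEdge a b := by
    intro i a b ha hb
    obtain ⟨hi, rfl⟩ := List.getElem?_eq_some_iff.1 ha
    obtain ⟨hi', rfl⟩ := List.getElem?_eq_some_iff.1 hb
    refine key i (q.take i) (q.drop (i+2)) _ _ (by simp; omega) ?_
    rw [← List.drop_eq_getElem_cons hi', ← List.drop_eq_getElem_cons hi, List.take_append_drop]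
  have hne : q ≠ [] := by rintro rfl; simp at hqlen
  refine ⟨M, hM, q, hqs, hqh, hql, ⟨hne, hqs.nodup hpn, ?_⟩, hdir, ?_⟩
  · have : q.IsChain M.Adj := hqc.imp (fun a b h => (c.adj M hM _ _).2 h.1)
    exact this
  · match q, hqlen, hqh, hdir, hqv with
    | a :: b :: r, _, hqh, hdir, hqv =>
      simp at hqh; subst hqh
      refine ⟨a, b, by simp, by simp, hdir 0 a b (by simp) (by simp), ?_⟩
      intro hv
      exact hqv ⟨a, b, by simp, by simp, c.visible_P hP hM h1 h2 hv⟩
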